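/- arXiv:2307.09265 — 9 statements merged into one kernel-verified Lean document; each statement's English description precedes it below -/
import Mathlib

section
/- Let K be a field and V a K-vector space of dimension n. Fix integers r ≥ 1, dimensions e_1 < e_2 < ... < e_r ≤ n and 0 < d_1 ≤ d_2 < e_1. Consider the set of configurations (U_1, U_2, W_1, ..., W_r) of subspaces of V with dim U_i = d_i, dim W_j = e_j, U_1 ⊆ W_1, U_2 ⊆ W_1 and W_1 ⊆ W_2 ⊆ ... ⊆ W_r. Then the GL(V)-action on this set of configurations has exactly two orbits if and only if min(d_1, e_1 − d_1) = 1 or min(d_2, e_1 − d_2) = 1. -/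
open Module

theorem aux_ext {K M V : Type*} [Field K] [AddCommGroup M] [Module K M] [AddCommGroup V] [Module K V]
    [FiniteDimensional K V] (f f' : M →ₗ[K] V) (hf : Function.Injective f)
    (hf' : Function.Injective f') : ∃ g : V ≃ₗ[K] V, ∀ x, g (f x) = f' x := by
  obtain ⟨D, hD⟩ := Submodule.exists_isCompl (LinearMap.range f)
  obtain ⟨D', hD'⟩ := Submodule.exists_isCompl (LinearMap.range f')
  let e1 := LinearEquiv.ofInjective f hf
  let e2 := LinearEquiv.ofInjective f' hf'
  have h0 : finrank K (LinearMap.range f) = finrank K (LinearMap.range f') :=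
    (e1.symm.trans e2).finrank_eq
  have h1 := Submodule.finrank_add_eq_of_isCompl hD
  have h2 := Submodule.finrank_add_eq_of_isCompl hD'
  have h3 : finrank K D = finrank K D' := by omega
  let e3 := LinearEquiv.ofFinrankEq D D' h3
  refine ⟨(Submodule.prodEquivOfIsCompl _ _ hD).symm ≪≫ₗ
    ((e1.symm.trans e2).prodCongr e3) ≪≫ₗ (Submodule.prodEquivOfIsCompl _ _ hD'), fun x => ?_⟩
  have : (Submodule.prodEquivOfIsCompl _ _ hD).symm (f x) = (e1 x, 0) := by
    rw [LinearEquiv.symm_apply_eq]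
    simp [e1]
  simp [this, e2]

theorem aux_step {K V : Type*} [Field K] [AddCommGroup V] [Module K V]
    [FiniteDimensional K V] (A B B' : Submodule K V) (h : A ⊓ B = A ⊓ B')
    (hB : finrank K B = finrank K B') :
    ∃ g : V ≃ₗ[K] V, (∀ x ∈ A, g x = x) ∧ B.map g.toLinearMap = B' := by
  have key : ∀ B : Submodule K V, ∃ C : Submodule K V, A ⊓ C = ⊥ ∧ B = (A ⊓ B) ⊔ C ∧
      finrank K (A ⊓ B : Submodule K V) + finrank K C = finrank K B := by
    intro B
    obtain ⟨E, hE⟩ := Submodule.exists_isCompl (A ⊓ B)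
    have hs : (A ⊓ B) ⊔ (B ⊓ E) = B := by
      rw [inf_comm B E, ← sup_inf_assoc_of_le E (inf_le_right : A ⊓ B ≤ B), hE.sup_eq_top, top_inf_eq]
    have hi : (A ⊓ B) ⊓ (B ⊓ E) = ⊥ := by
      rw [← inf_assoc, inf_assoc A B B, inf_idem, hE.inf_eq_bot]
    refine ⟨B ⊓ E, ?_, hs.symm, ?_⟩
    · rw [← inf_assoc, hE.inf_eq_bot]
    · have := Submodule.finrank_sup_add_finrank_inf_eq (A ⊓ B) (B ⊓ E)
      rw [hs, hi, finrank_bot] at this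
      omega
  obtain ⟨C, hC, hBC, hd⟩ := key B
  obtain ⟨C', hC', hBC', hd'⟩ := key B'
  have h3 : finrank K C = finrank K C' := by rw [h] at hd; omega
  let φ := LinearEquiv.ofFinrankEq C C' h3
  obtain ⟨g, hg⟩ := aux_ext (A.subtype.coprod C.subtype)
    (A.subtype.coprod (C'.subtype ∘ₗ φ.toLinearMap)) (by
      rw [← LinearMap.ker_eq_bot, LinearMap.ker_coprod_of_disjoint_range]
      · simp
      · simpa [disjoint_iff] using hC) (by
      rw [← LinearMap.ker_eq_bot, LinearMap.ker_coprod_of_disjoint_range]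
      · simp [LinearMap.ker_comp]
      · rw [LinearMap.range_comp]
        simpa [disjoint_iff] using hC')
  have hgA : ∀ x ∈ A, g x = x := by
    intro x hx
    simpa using hg (⟨x, hx⟩, 0)
  refine ⟨g, hgA, ?_⟩
  have hgC : C.map g.toLinearMap ≤ C' := by
    rintro _ ⟨x, hx, rfl⟩
    have := hg (0, ⟨x, hx⟩)
    simp at this
    simp [this]
  apply Submodule.eq_of_le_of_finrank_eq
  · rw [hBC, Submodule.map_sup]
    apply sup_le
    · rintro _ ⟨x, hx, rfl⟩
      have h' : x ∈ A ⊓ B' := h ▸ hx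
      have := hgA x h'.1
      simp only [LinearEquiv.coe_coe, this]
      exact h'.2
    · refine hgC.trans ?_
      rw [hBC']
      exact le_sup_right
  · rw [← hB]
    exact LinearEquiv.finrank_map_eq g B

theorem aux_map_fix {K V : Type*} [Field K] [AddCommGroup V] [Module K V]
    (A X : Submodule K V) (g : V ≃ₗ[K] V) (hg : ∀ x ∈ A, g x = x) (hX : X ≤ A) :
    X.map g.toLinearMap = X := by
  ext y
  constructor
  · rintro ⟨x, hx, rfl⟩
    simpa [hg x (hX hx)] using hx
  · intro hy
    exact ⟨y, hy, hg y (hX hy)⟩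

theorem aux_pair {K V : Type*} [Field K] [AddCommGroup V] [Module K V]
    [FiniteDimensional K V] (A B A' B' : Submodule K V) (hA : finrank K A = finrank K A')
    (hB : finrank K B = finrank K B')
    (h : finrank K (A ⊓ B : Submodule K V) = finrank K (A' ⊓ B' : Submodule K V)) :
    ∃ g : V ≃ₗ[K] V, A.map g.toLinearMap = A' ∧ B.map g.toLinearMap = B' := by
  obtain ⟨g0, -, h0⟩ := aux_step ⊥ (A ⊓ B) (A' ⊓ B') (by simp) h
  have h0' : A.map g0.toLinearMap ⊓ B.map g0.toLinearMap = A' ⊓ B' := by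
    rw [← h0, Submodule.map_inf _ g0.injective]
  have hA0 : finrank K (A.map g0.toLinearMap) = finrank K A := LinearEquiv.finrank_map_eq g0 A
  have hB0 : finrank K (B.map g0.toLinearMap) = finrank K B := LinearEquiv.finrank_map_eq g0 B
  generalize hA1 : A.map g0.toLinearMap = A1 at *
  generalize hB1 : B.map g0.toLinearMap = B1 at *
  obtain ⟨g1, f1, h1⟩ := aux_step (A' ⊓ B') A1 A' (by
    rw [inf_eq_left.2 (inf_le_left : A' ⊓ B' ≤ A'), ← h0', inf_eq_left.2 inf_le_left]) (by omega)
  have h1' : A' ⊓ B1.map g1.toLinearMap = A' ⊓ B' := by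
    rw [← h1, ← Submodule.map_inf _ g1.injective, h0', h1]
    exact aux_map_fix _ _ g1 f1 le_rfl
  have hB2 : finrank K (B1.map g1.toLinearMap) = finrank K B1 := LinearEquiv.finrank_map_eq g1 B1
  obtain ⟨g2, f2, h2⟩ := aux_step A' (B1.map g1.toLinearMap) B' h1' (by omega)
  refine ⟨g0 ≪≫ₗ g1 ≪≫ₗ g2, ?_, ?_⟩
  · have : A' = A'.map g2.toLinearMap := (aux_map_fix _ _ g2 f2 le_rfl).symm
    conv_rhs => rw [this, ← h1, ← hA1]
    rw [← Submodule.map_comp, ← Submodule.map_comp]; rfl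
  · rw [← h2, ← hB1, ← Submodule.map_comp, ← Submodule.map_comp]; rfl

theorem aux_chain {K V : Type*} [Field K] [AddCommGroup V] [Module K V]
    [FiniteDimensional K V] (r : ℕ) (hr : 0 < r) (A B A' B' : Submodule K V)
    (W W' : Fin r → Submodule K V)
    (hA : finrank K A = finrank K A')
    (hB : finrank K B = finrank K B')
    (h : finrank K (A ⊓ B : Submodule K V) = finrank K (A' ⊓ B' : Submodule K V))
    (hW : ∀ j, finrank K (W j) = finrank K (W' j))
    (a1 : A ≤ W ⟨0, hr⟩) (a2 : B ≤ W ⟨0, hr⟩) (a3 : Monotone W)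
    (b1 : A' ≤ W' ⟨0, hr⟩) (b2 : B' ≤ W' ⟨0, hr⟩) (b3 : Monotone W') :
    ∃ g : V ≃ₗ[K] V, A.map g.toLinearMap = A' ∧ B.map g.toLinearMap = B' ∧
      ∀ j, (W j).map g.toLinearMap = W' j := by
  have key : ∀ m : ℕ, ∃ g : V ≃ₗ[K] V, A.map g.toLinearMap = A' ∧ B.map g.toLinearMap = B' ∧
      ∀ j : Fin r, j.1 < m → (W j).map g.toLinearMap = W' j := by
    intro m
    induction m with
    | zero =>
      obtain ⟨g, h1, h2⟩ := aux_pair A B A' B' hA hB h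
      exact ⟨g, h1, h2, by simp⟩
    | succ m ih =>
      obtain ⟨g, h1, h2, h3⟩ := ih
      by_cases hm : m < r
      swap
      · exact ⟨g, h1, h2, fun j _ => h3 j (by omega)⟩
      let S : Submodule K V := A' ⊔ B' ⊔ ⨆ j : {j : Fin r // j.1 < m}, W' j.1
      have z : ∀ j : Fin r, (⟨0, hr⟩ : Fin r) ≤ j := fun j => Fin.le_def.2 (Nat.zero_le _)
      have hS' : S ≤ W' ⟨m, hm⟩ := by
        refine sup_le (sup_le (b1.trans (b3 (z _))) (b2.trans (b3 (z _)))) (iSup_le ?_)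
        rintro ⟨j, hj⟩
        exact b3 (Fin.le_def.2 hj.le)
      have hS : S ≤ (W ⟨m, hm⟩).map g.toLinearMap := by
        refine sup_le (sup_le ?_ ?_) (iSup_le ?_)
        · rw [← h1]; exact Submodule.map_mono (a1.trans (a3 (z _)))
        · rw [← h2]; exact Submodule.map_mono (a2.trans (a3 (z _)))
        · rintro ⟨j, hj⟩
          rw [← h3 j hj]
          exact Submodule.map_mono (a3 (Fin.le_def.2 hj.le))
      obtain ⟨k, f, hk⟩ := aux_step S ((W ⟨m, hm⟩).map g.toLinearMap) (W' ⟨m, hm⟩)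
        (by rw [inf_eq_left.2 hS, inf_eq_left.2 hS'])
        (by rw [← hW]; exact LinearEquiv.finrank_map_eq g _)
      have comp : ∀ X : Submodule K V, X.map (g ≪≫ₗ k).toLinearMap =
          (X.map g.toLinearMap).map k.toLinearMap := by
        intro X; rw [← Submodule.map_comp]; rfl
      refine ⟨g ≪≫ₗ k, ?_, ?_, ?_⟩
      · rw [comp, h1]; exact aux_map_fix S _ k f (le_sup_left.trans le_sup_left)
      · rw [comp, h2]; exact aux_map_fix S _ k f (le_sup_right.trans le_sup_left)
      · intro j hj
        rw [comp]
        by_cases hjm : j.1 < m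
        · rw [h3 j hjm]
          refine aux_map_fix S _ k f (le_trans ?_ le_sup_right)
          exact le_iSup (fun j : {j : Fin r // j.1 < m} => W' j.1) ⟨j, hjm⟩
        · have : j = ⟨m, hm⟩ := Fin.ext (by simp; omega)
          rw [this, hk]
  obtain ⟨g, h1, h2, h3⟩ := key r
  exact ⟨g, h1, h2, fun j => h3 j j.2⟩

theorem aux_exists {K V : Type*} [Field K] [AddCommGroup V] [Module K V]
    [FiniteDimensional K V] (n r d1 d2 : ℕ) (hn : finrank K V = n)
    (hr : 0 < r) (e : Fin r → ℕ) (he : StrictMono e) (hen : ∀ j, e j ≤ n)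
    (hd12 : d1 ≤ d2) (hd2 : d2 < e ⟨0, hr⟩) (k : ℕ) (hk : k ≤ d1)
    (hk' : d1 + d2 ≤ e ⟨0, hr⟩ + k) :
    ∃ c : Submodule K V × Submodule K V × (Fin r → Submodule K V),
          (finrank K c.1 = d1 ∧ finrank K c.2.1 = d2 ∧
            (∀ j, finrank K (c.2.2 j) = e j) ∧
            c.1 ≤ c.2.2 ⟨0, hr⟩ ∧ c.2.1 ≤ c.2.2 ⟨0, hr⟩ ∧ Monotone c.2.2) ∧
          finrank K (c.1 ⊓ c.2.1 : Submodule K V) = k := by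
  let b := finBasisOfFinrankEq K V hn
  have he0 := hen ⟨0, hr⟩
  let T : ℕ → ℕ → Submodule K V := fun p q =>
    Submodule.span K (b '' {i | p ≤ i.1 ∧ i.1 < q})
  have hT : ∀ p q, p ≤ q → q ≤ n → finrank K (T p q) = q - p := by
    intro p q hpq hq
    classical
    haveI : Fintype (b '' {i | p ≤ i.1 ∧ i.1 < q} : Set V) := Fintype.ofFinite _
    have hli : LinearIndepOn K id (b '' {i | p ≤ i.1 ∧ i.1 < q}) :=
      (b.linearIndependent.linearIndepOn _).id_image
    have := finrank_span_set_eq_card hli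
    rw [show finrank K (T p q) = _ from this, Set.toFinset_card, ← Nat.card_eq_fintype_card, Nat.card_coe_set_eq,
      Set.ncard_image_of_injective _ b.injective]
    have : (Fin.val '' {i : Fin n | p ≤ i.1 ∧ i.1 < q}) = Set.Ico p q := by
      ext x
      simp only [Set.mem_image, Set.mem_setOf_eq, Set.mem_Ico]
      constructor
      · rintro ⟨i, hi, rfl⟩; exact hi
      · intro hx; exact ⟨⟨x, by omega⟩, hx, rfl⟩
    rw [← Set.ncard_image_of_injective _ Fin.val_injective, this, ← Finset.coe_Ico,
      Set.ncard_coe_finset, Nat.card_Ico]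
  have hmono : ∀ p q p' q', p' ≤ p → q ≤ q' → T p q ≤ T p' q' := by
    intro p q p' q' h1 h2
    apply Submodule.span_mono
    apply Set.image_mono
    intro i hi
    simp only [Set.mem_setOf_eq] at hi ⊢
    omega
  have h1 := hT 0 d1 (by omega) (by omega)
  have h2 := hT (d1 - k) (d1 - k + d2) (by omega) (by omega)
  refine ⟨(T 0 d1, T (d1 - k) (d1 - k + d2), fun j => T 0 (e j)), ⟨by simpa using h1,
    by simpa using h2, fun j => by simpa using hT 0 (e j) (by omega) (hen j),
    hmono _ _ _ _ le_rfl (by omega), hmono _ _ _ _ (by omega) (by omega),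
    fun i j hij => hmono _ _ _ _ le_rfl (he.monotone hij)⟩, ?_⟩
  have hs : T 0 d1 ⊔ T (d1 - k) (d1 - k + d2) = T 0 (d1 - k + d2) := by
    simp only [T]
    rw [← Submodule.span_union, ← Set.image_union]
    congr 2
    ext i
    simp only [Set.mem_union, Set.mem_setOf_eq]
    omega
  have h3 := Submodule.finrank_sup_add_finrank_inf_eq (T 0 d1) (T (d1 - k) (d1 - k + d2))
  have h4 := hT 0 (d1 - k + d2) (by omega) (by omega)
  rw [hs] at h3
  dsimp only
  omega

/-- A tree variety with two branches of length one attached to a trunk has exactly two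
`GL(V)`-orbits iff one of the branches has minimum width one. -/
theorem two_orbits_iff_min_width_one
    (K : Type*) [Field K] (V : Type*) [AddCommGroup V] [Module K V]
    [FiniteDimensional K V] (n r d1 d2 : ℕ) (hn : finrank K V = n)
    (hr : 0 < r) (e : Fin r → ℕ) (he : StrictMono e) (hen : ∀ j, e j ≤ n)
    (hd1 : 0 < d1) (hd12 : d1 ≤ d2) (hd2 : d2 < e ⟨0, hr⟩) :
    ({ O : Set (Submodule K V × Submodule K V × (Fin r → Submodule K V)) |
        ∃ c : Submodule K V × Submodule K V × (Fin r → Submodule K V),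
          (finrank K c.1 = d1 ∧ finrank K c.2.1 = d2 ∧
            (∀ j, finrank K (c.2.2 j) = e j) ∧
            c.1 ≤ c.2.2 ⟨0, hr⟩ ∧ c.2.1 ≤ c.2.2 ⟨0, hr⟩ ∧ Monotone c.2.2) ∧
          O = { c' | ∃ g : V ≃ₗ[K] V,
            c.1.map g.toLinearMap = c'.1 ∧ c.2.1.map g.toLinearMap = c'.2.1 ∧
            ∀ j, (c.2.2 j).map g.toLinearMap = c'.2.2 j } }.ncard = 2) ↔
    (min d1 (e ⟨0, hr⟩ - d1) = 1 ∨ min d2 (e ⟨0, hr⟩ - d2) = 1) := by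
  let orb : (Submodule K V × Submodule K V × (Fin r → Submodule K V)) →
      Set (Submodule K V × Submodule K V × (Fin r → Submodule K V)) := fun c =>
    { c' | ∃ g : V ≃ₗ[K] V,
            c.1.map g.toLinearMap = c'.1 ∧ c.2.1.map g.toLinearMap = c'.2.1 ∧
            ∀ j, (c.2.2 j).map g.toLinearMap = c'.2.2 j }
  have comp : ∀ (g k : V ≃ₗ[K] V) (X : Submodule K V), X.map (g ≪≫ₗ k).toLinearMap =
      (X.map g.toLinearMap).map k.toLinearMap := by
    intro g k X; rw [← Submodule.map_comp]; rfl
  have trans : ∀ c c' , c' ∈ orb c → orb c' ⊆ orb c := by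
    rintro c c' ⟨g, h1, h2, h3⟩ c'' ⟨g', h1', h2', h3'⟩
    refine ⟨g ≪≫ₗ g', ?_, ?_, fun j => ?_⟩
    · rw [comp, h1, h1']
    · rw [comp, h2, h2']
    · rw [comp, h3, h3']
  have key := fun k (hk : k ∈ Set.Icc (d1 + d2 - e ⟨0, hr⟩) d1) =>
    aux_exists (K := K) (V := V) n r d1 d2 hn hr e he hen hd12 hd2 k hk.2
      (by have := hk.1; omega)
  have key' : ∀ k : ℕ, ∃ c : Submodule K V × Submodule K V × (Fin r → Submodule K V),
      k ∈ Set.Icc (d1 + d2 - e ⟨0, hr⟩) d1 →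
          (finrank K c.1 = d1 ∧ finrank K c.2.1 = d2 ∧
            (∀ j, finrank K (c.2.2 j) = e j) ∧
            c.1 ≤ c.2.2 ⟨0, hr⟩ ∧ c.2.1 ≤ c.2.2 ⟨0, hr⟩ ∧ Monotone c.2.2) ∧
          finrank K (c.1 ⊓ c.2.1 : Submodule K V) = k := by
    intro k
    by_cases hk : k ∈ Set.Icc (d1 + d2 - e ⟨0, hr⟩) d1
    · obtain ⟨c, hc⟩ := key k hk
      exact ⟨c, fun _ => hc⟩
    · exact ⟨(⊥, ⊥, fun _ => ⊥), fun h => absurd h hk⟩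
  choose c hc using key'
  have himg : { O : Set (Submodule K V × Submodule K V × (Fin r → Submodule K V)) |
        ∃ c : Submodule K V × Submodule K V × (Fin r → Submodule K V),
          (finrank K c.1 = d1 ∧ finrank K c.2.1 = d2 ∧
            (∀ j, finrank K (c.2.2 j) = e j) ∧
            c.1 ≤ c.2.2 ⟨0, hr⟩ ∧ c.2.1 ≤ c.2.2 ⟨0, hr⟩ ∧ Monotone c.2.2) ∧
          O = { c' | ∃ g : V ≃ₗ[K] V,
            c.1.map g.toLinearMap = c'.1 ∧ c.2.1.map g.toLinearMap = c'.2.1 ∧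
            ∀ j, (c.2.2 j).map g.toLinearMap = c'.2.2 j } } =
      (fun k => orb (c k)) '' (Set.Icc (d1 + d2 - e ⟨0, hr⟩) d1) := by
    ext O
    constructor
    · rintro ⟨x, ⟨x1, x2, x3, x4, x5, x6⟩, rfl⟩
      have hk : finrank K (x.1 ⊓ x.2.1 : Submodule K V) ∈
          Set.Icc (d1 + d2 - e ⟨0, hr⟩) d1 := by
        have h1 := Submodule.finrank_sup_add_finrank_inf_eq x.1 x.2.1
        have h2 := Submodule.finrank_mono (sup_le x4 x5)
        have h3 := Submodule.finrank_mono (inf_le_left : x.1 ⊓ x.2.1 ≤ x.1)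
        rw [x3] at h2
        constructor <;> omega
      obtain ⟨⟨y1, y2, y3, y4, y5, y6⟩, y7⟩ := hc _ hk
      refine ⟨_, hk, ?_⟩
      apply Set.Subset.antisymm
      · apply trans x
        exact aux_chain r hr _ _ _ _ _ _ (by rw [x1, y1]) (by rw [x2, y2]) y7.symm
          (fun j => by rw [x3, y3]) x4 x5 x6 y4 y5 y6
      · apply trans _ x
        exact aux_chain r hr _ _ _ _ _ _ (by rw [x1, y1]) (by rw [x2, y2]) y7
          (fun j => by rw [x3, y3]) y4 y5 y6 x4 x5 x6
    · rintro ⟨k, hk, rfl⟩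
      exact ⟨c k, (hc k hk).1, rfl⟩
  have hinj : Set.InjOn (fun k => orb (c k)) (Set.Icc (d1 + d2 - e ⟨0, hr⟩) d1) := by
    intro k hk l hl hkl
    have hm : c l ∈ orb (c l) := ⟨LinearEquiv.refl K V, by simp, by simp, by simp⟩
    have hm' : c l ∈ orb (c k) := by
      have h : orb (c k) = orb (c l) := hkl
      rw [h]; exact hm
    obtain ⟨g, h1, h2, -⟩ := hm'
    rw [← (hc k hk).2, ← (hc l hl).2, ← h1, ← h2, ← Submodule.map_inf _ g.injective]
    exact (LinearEquiv.finrank_map_eq g _).symm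
  rw [himg, Set.ncard_image_of_injOn hinj, ← Finset.coe_Icc, Set.ncard_coe_finset, Nat.card_Icc]
  omega
end

section
/- Let K be a field and V a K-vector space of dimension n. Let (A_1 ⊆ ... ⊆ A_p, B_1 ⊆ ... ⊆ B_q) and (A'_1 ⊆ ... ⊆ A'_p, B'_1 ⊆ ... ⊆ B'_q) be two pairs of partial flags in V with dim A_i = dim A'_i and dim B_j = dim B'_j for all i, j. Then there exists g ∈ GL(V) with g(A_i) = A'_i and g(B_j) = B'_j for all i, j if and only if dim(A_i ∩ B_j) = dim(A'_i ∩ B'_j) for all 1 ≤ i ≤ p and 1 ≤ j ≤ q. -/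
open Module

section helpers
variable {K : Type*} [Field K] {V : Type*} [AddCommGroup V] [Module K V] [FiniteDimensional K V]

lemma aux_exists_C (A B : ℕ → Submodule K V) (hA : Monotone A) (hB : Monotone B) (i j : ℕ) :
    ∃ C : Submodule K V,
      C ⊔ ((A i ⊓ B (j+1)) ⊔ (A (i+1) ⊓ B j)) = A (i+1) ⊓ B (j+1) ∧
      finrank K C + finrank K ↥(A i ⊓ B (j+1)) + finrank K ↥(A (i+1) ⊓ B j)
        = finrank K ↥(A (i+1) ⊓ B (j+1)) + finrank K ↥(A i ⊓ B j) := by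
  have hAi := hA (Nat.le_succ i)
  have hBj := hB (Nat.le_succ j)
  simp only [Nat.succ_eq_add_one] at hAi hBj
  set D := (A i ⊓ B (j+1)) ⊔ (A (i+1) ⊓ B j) with hD
  have hDle : D ≤ A (i+1) ⊓ B (j+1) :=
    sup_le (inf_le_inf_right _ hAi) (inf_le_inf_left _ hBj)
  obtain ⟨C0, hC0⟩ := exists_isCompl D
  have h1 : (C0 ⊓ (A (i+1) ⊓ B (j+1))) ⊔ D = A (i+1) ⊓ B (j+1) := by
    rw [sup_comm, ← sup_inf_assoc_of_le _ hDle, hC0.sup_eq_top, top_inf_eq]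
  refine ⟨C0 ⊓ (A (i+1) ⊓ B (j+1)), h1, ?_⟩
  have h2 := Submodule.finrank_sup_add_finrank_inf_eq (C0 ⊓ (A (i+1) ⊓ B (j+1))) D
  have h3 : (C0 ⊓ (A (i+1) ⊓ B (j+1))) ⊓ D = ⊥ := by
    rw [eq_bot_iff, ← hC0.inf_eq_bot]
    exact le_inf inf_le_right (inf_le_left.trans inf_le_left)
  rw [h1, h3, finrank_bot] at h2
  have h4 := Submodule.finrank_sup_add_finrank_inf_eq (A i ⊓ B (j+1)) (A (i+1) ⊓ B j)
  have h5 : (A i ⊓ B (j+1)) ⊓ (A (i+1) ⊓ B j) = A i ⊓ B j := by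
    apply le_antisymm
    · exact le_inf (inf_le_left.trans inf_le_left) (inf_le_right.trans inf_le_right)
    · exact le_inf (inf_le_inf_left _ hBj) (inf_le_inf_right _ hAi)
  rw [h5, ← hD] at h4
  omega

lemma aux_sup (A B : ℕ → Submodule K V) (C : ℕ → ℕ → Submodule K V)
    (hA0 : A 0 = ⊥) (hB0 : B 0 = ⊥)
    (hC : ∀ i j, C i j ⊔ ((A i ⊓ B (j+1)) ⊔ (A (i+1) ⊓ B j)) = A (i+1) ⊓ B (j+1))
    (i j : ℕ) : A i ⊓ B j = ⨆ a, ⨆ b, ⨆ (_ : a < i ∧ b < j), C a b := by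
  apply le_antisymm
  · induction i generalizing j with
    | zero => simp [hA0]
    | succ i ih =>
      induction j with
      | zero => simp [hB0]
      | succ j ihj =>
        rw [← hC]
        refine sup_le ?_ (sup_le ((ih (j+1)).trans ?_) (ihj.trans ?_))
        · exact le_iSup_of_le i (le_iSup_of_le j (le_iSup_of_le (by omega) le_rfl))
        · exact iSup_mono fun a => iSup_mono fun b => iSup_mono' fun h => ⟨by omega, le_rfl⟩
        · exact iSup_mono fun a => iSup_mono fun b => iSup_mono' fun h => ⟨by omega, le_rfl⟩
  · have mA : Monotone fun i => A i ⊓ B j := by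
      cases j with
      | zero => simp only [hB0, inf_bot_eq]; exact monotone_const
      | succ j =>
        refine monotone_nat_of_le_succ fun i => ?_
        rw [← hC]; exact le_sup_left.trans le_sup_right
    have mB : ∀ i, Monotone fun j => A i ⊓ B j := by
      intro i
      cases i with
      | zero => simp only [hA0, bot_inf_eq]; exact monotone_const
      | succ i =>
        refine monotone_nat_of_le_succ fun j => ?_
        rw [← hC i j]; exact le_sup_right.trans le_sup_right
    refine iSup_le fun a => iSup_le fun b => iSup_le fun h => ?_
    have h1 : C a b ≤ A (a+1) ⊓ B (b+1) := by rw [← hC]; exact le_sup_left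
    have h2 : A (a+1) ⊓ B (b+1) ≤ A (a+1) ⊓ B j := mB (a+1) (show b+1 ≤ j by omega)
    have h3 : A (a+1) ⊓ B j ≤ A i ⊓ B j := mA (show a+1 ≤ i by omega)
    exact h1.trans (h2.trans h3)

lemma aux_tele (c d : ℕ → ℕ → ℕ) (h0 : ∀ j, d 0 j = 0) (h0' : ∀ i, d i 0 = 0)
    (h : ∀ i j, c i j + d i (j+1) + d (i+1) j = d (i+1) (j+1) + d i j) (P Q : ℕ) :
    ∑ x ∈ Finset.range P ×ˢ Finset.range Q, c x.1 x.2 = d P Q := by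
  rw [Finset.sum_product]
  have row : ∀ i b, ∑ j ∈ Finset.range b, c i j + d i b = d (i+1) b := by
    intro i b
    induction b with
    | zero => simp [h0']
    | succ b ih => rw [Finset.sum_range_succ]; have := h i b; omega
  induction P with
  | zero => simp [h0]
  | succ P ih => rw [Finset.sum_range_succ]; have := row P Q; simp only at ih ⊢; omega

lemma aux_equiv {ι : Type*} [Fintype ι] [DecidableEq ι] (C : ι → Submodule K V)
    (hs : ⨆ x, C x = ⊤) (hd : ∑ x, finrank K (C x) = finrank K V) :
    ∃ E : (∀ x, C x) ≃ₗ[K] V, ∀ x (c : C x), E (Pi.single x c) = c := by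
  let f : (∀ x, C x) →ₗ[K] V := LinearMap.lsum K (fun x => C x) K fun x => (C x).subtype
  have hf : ∀ x (c : C x), f (Pi.single x c) = c := fun x c => by
    exact LinearMap.lsum_piSingle _ _ K (fun x => (C x).subtype) x c
  have hsurj : Function.Surjective f := by
    rw [← LinearMap.range_eq_top, eq_top_iff, ← hs]
    exact iSup_le fun x c hc => ⟨Pi.single x ⟨c, hc⟩, hf x ⟨c, hc⟩⟩
  have hfr : finrank K (∀ x, C x) = finrank K V := by rw [Module.finrank_pi_fintype, hd]
  have hinj := (LinearMap.injective_iff_surjective_of_finrank_eq_finrank hfr).2 hsurj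
  exact ⟨LinearEquiv.ofBijective f ⟨hinj, hsurj⟩, hf⟩

lemma aux_equiv2 {ι : Type*} [Fintype ι] [DecidableEq ι] (C C' : ι → Submodule K V)
    (hs : ⨆ x, C x = ⊤) (hd : ∑ x, finrank K (C x) = finrank K V)
    (hs' : ⨆ x, C' x = ⊤) (h : ∀ x, finrank K (C x) = finrank K (C' x)) :
    ∃ g : V ≃ₗ[K] V, ∀ x, (C x).map g.toLinearMap = C' x := by
  obtain ⟨E, hE⟩ := aux_equiv C hs hd
  obtain ⟨E', hE'⟩ := aux_equiv C' hs' (by rw [← hd]; exact (Finset.sum_congr rfl fun x _ => (h x).symm))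
  let φ : ∀ x, C x ≃ₗ[K] C' x := fun x => LinearEquiv.ofFinrankEq _ _ (h x)
  let g : V ≃ₗ[K] V := (E.symm.trans (LinearEquiv.piCongrRight φ)).trans E'
  have hg : ∀ x (c : C x), g c = φ x c := by
    intro x c
    have h1 : E.symm (c : V) = Pi.single x c := by rw [← hE x c, E.symm_apply_apply]
    have h2 : LinearEquiv.piCongrRight φ (Pi.single x c) = Pi.single x (φ x c) := by
      ext y
      rcases eq_or_ne y x with rfl | hy
      · simp
      · simp [hy]
    change E' (LinearEquiv.piCongrRight φ (E.symm c)) = _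
    rw [h1, h2, hE']
  refine ⟨g, fun x => le_antisymm ?_ ?_⟩
  · rintro _ ⟨c, hc, rfl⟩
    have := hg x ⟨c, hc⟩
    change g c ∈ _
    rw [this]; exact (φ x _).2
  · intro c hc
    refine ⟨(φ x).symm ⟨c, hc⟩, ((φ x).symm ⟨c, hc⟩).2, ?_⟩
    change g _ = _
    rw [hg]; simp

lemma aux_core (A A' B B' : ℕ → Submodule K V)
    (hA : Monotone A) (hA' : Monotone A') (hB : Monotone B) (hB' : Monotone B')
    (hA0 : A 0 = ⊥) (hA0' : A' 0 = ⊥) (hB0 : B 0 = ⊥) (hB0' : B' 0 = ⊥)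
    (P Q : ℕ) (hP : A P = ⊤) (hP' : A' P = ⊤) (hQ : B Q = ⊤) (hQ' : B' Q = ⊤)
    (h : ∀ i j, finrank K ↥(A i ⊓ B j) = finrank K ↥(A' i ⊓ B' j)) :
    ∃ g : V ≃ₗ[K] V, ∀ i j, i ≤ P → j ≤ Q →
      (A i ⊓ B j).map g.toLinearMap = A' i ⊓ B' j := by
  choose C hC hCd using aux_exists_C A B hA hB
  choose C' hC' hCd' using aux_exists_C A' B' hA' hB'
  have S := aux_sup A B C hA0 hB0 hC
  have S' := aux_sup A' B' C' hA0' hB0' hC'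
  have top : ∀ (D : ℕ → ℕ → Submodule K V),
      (⨆ a, ⨆ b, ⨆ (_ : a < P ∧ b < Q), D a b) = ⊤ →
      ⨆ x : ↥(Finset.range P ×ˢ Finset.range Q), D x.1.1 x.1.2 = ⊤ := by
    intro D hD
    rw [eq_top_iff, ← hD]
    refine iSup_le fun a => iSup_le fun b => iSup_le fun h => ?_
    exact le_iSup (fun x : ↥(Finset.range P ×ˢ Finset.range Q) => D x.1.1 x.1.2)
      ⟨(a, b), by simp [h.1, h.2]⟩
  obtain ⟨g, hg⟩ := aux_equiv2
    (fun x : ↥(Finset.range P ×ˢ Finset.range Q) => C x.1.1 x.1.2)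
    (fun x => C' x.1.1 x.1.2)
    (top C (by rw [← S, hP, hQ, inf_top_eq]))
    (by
      rw [Finset.sum_coe_sort (Finset.range P ×ˢ Finset.range Q)
        (fun x => finrank K (C x.1 x.2))]
      rw [aux_tele (fun i j => finrank K (C i j)) (fun i j => finrank K ↥(A i ⊓ B j))
        (by simp [hA0]) (by simp [hB0]) hCd]
      rw [hP, hQ, inf_top_eq, finrank_top])
    (top C' (by rw [← S', hP', hQ', inf_top_eq]))
    (by
      intro x
      have h1 := hCd x.1.1 x.1.2
      have h2 := hCd' x.1.1 x.1.2
      rw [h, h, h, h] at h1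
      change finrank K (C x.1.1 x.1.2) = finrank K (C' x.1.1 x.1.2)
      omega)
  refine ⟨g, fun i j hi hj => ?_⟩
  rw [S, S']
  simp only [Submodule.map_iSup]
  refine iSup_congr fun a => iSup_congr fun b => iSup_congr fun hab => ?_
  exact hg ⟨(a, b), by simp; omega⟩

/-- extension of a finite flag by `⊥` and `⊤` -/
def auxExt {p : ℕ} (A : Fin p → Submodule K V) : ℕ → Submodule K V
  | 0 => ⊥
  | i+1 => if h : i < p then A ⟨i, h⟩ else ⊤

lemma auxExt_mono {p : ℕ} (A : Fin p → Submodule K V) (hA : Monotone A) :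
    Monotone (auxExt A) := by
  refine monotone_nat_of_le_succ fun i => ?_
  cases i with
  | zero => simp [auxExt]
  | succ i =>
    simp only [auxExt]
    split_ifs with h1 h2
    · exact hA (by simp)
    · exact le_top
    · omega
    · exact le_rfl

lemma auxExt_cases {p : ℕ} (A A' : Fin p → Submodule K V) (i : ℕ) :
    (auxExt A i = ⊥ ∧ auxExt A' i = ⊥) ∨ (auxExt A i = ⊤ ∧ auxExt A' i = ⊤) ∨
      ∃ k, auxExt A i = A k ∧ auxExt A' i = A' k := by
  cases i with
  | zero => simp [auxExt]
  | succ i =>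
    by_cases h : i < p
    · right; right; exact ⟨⟨i, h⟩, by simp [auxExt, h], by simp [auxExt, h]⟩
    · right; left; simp [auxExt, h]

end helpers

/-- Two pairs of partial flags with the same dimension data lie in the same GL(V)-orbit
iff the dimensions of all pairwise intersections agree. -/
theorem pairs_of_flags_same_orbit_iff_intersection_dims
    (K : Type*) [Field K] (V : Type*) [AddCommGroup V] [Module K V]
    [FiniteDimensional K V] (n p q : ℕ) (hn : finrank K V = n)
    (A A' : Fin p → Submodule K V) (B B' : Fin q → Submodule K V)
    (hA : Monotone A) (hA' : Monotone A') (hB : Monotone B) (hB' : Monotone B')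
    (hdA : ∀ i, finrank K (A i) = finrank K (A' i))
    (hdB : ∀ j, finrank K (B j) = finrank K (B' j)) :
    (∃ g : V ≃ₗ[K] V,
      (∀ i, (A i).map g.toLinearMap = A' i) ∧ (∀ j, (B j).map g.toLinearMap = B' j)) ↔
    (∀ i j, finrank K ↥(A i ⊓ B j) = finrank K ↥(A' i ⊓ B' j)) := by
  constructor
  · rintro ⟨g, h1, h2⟩ i j
    rw [← h1, ← h2, ← Submodule.map_inf _ g.injective]
    exact (LinearEquiv.finrank_map_eq g _).symm
  · intro h
    have tA : ∀ A : Fin p → Submodule K V, auxExt A (p+1) = ⊤ := fun A => by simp [auxExt]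
    have tB : ∀ A : Fin q → Submodule K V, auxExt A (q+1) = ⊤ := fun A => by simp [auxExt]
    obtain ⟨g, hg⟩ := aux_core (auxExt A) (auxExt A') (auxExt B) (auxExt B')
      (auxExt_mono A hA) (auxExt_mono A' hA') (auxExt_mono B hB) (auxExt_mono B' hB')
      rfl rfl rfl rfl (p+1) (q+1) (tA _) (tA _) (tB _) (tB _) (by
        intro i j
        rcases auxExt_cases A A' i with ⟨h1, h2⟩ | ⟨h1, h2⟩ | ⟨k, h1, h2⟩ <;>
        rcases auxExt_cases B B' j with ⟨h3, h4⟩ | ⟨h3, h4⟩ | ⟨l, h3, h4⟩ <;>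
        rw [h1, h2, h3, h4] <;>
        first
        | (rw [bot_inf_eq, bot_inf_eq]; done)
        | (rw [bot_inf_eq]; done)
        | (rw [inf_bot_eq, inf_bot_eq]; done)
        | (rw [inf_bot_eq]; done)
        | (rw [top_inf_eq]; done)
        | (rw [top_inf_eq, top_inf_eq, hdB]; done)
        | (rw [inf_top_eq, inf_top_eq, hdA]; done)
        | rw [h])
    refine ⟨g, fun i => ?_, fun j => ?_⟩
    · have := hg (i+1) (q+1) (by omega) le_rfl
      rw [tB, tB, inf_top_eq, inf_top_eq] at this
      simpa [auxExt] using this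
    · have := hg (p+1) (j+1) le_rfl (by omega)
      rw [tA, tA, top_inf_eq, top_inf_eq] at this
      simpa [auxExt] using this
end

section
/- Let K be an algebraically closed field and V a K-vector space of dimension n. Fix integers u_i, v_i for i = 1, 2, 3 with 0 < u_i < v_i < n. Then the GL(V)-action on configurations (U_1 ⊆ V_1, U_2 ⊆ V_2, U_3 ⊆ V_3) of six subspaces of V with dim U_i = u_i and dim V_i = v_i has infinitely many orbits. -/
open Module

namespace FlagAux

variable {K : Type*} [Field K]

/-- coordinate subspace -/
def X (K : Type*) [Field K] {ι : Type*} (S : Set ι) : Submodule K (ι → K) :=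
  ⨅ i ∈ Sᶜ, LinearMap.ker (LinearMap.proj i : (ι → K) →ₗ[K] K)

lemma mem_X {ι : Type*} {S : Set ι} {x : ι → K} : x ∈ X K S ↔ ∀ i, i ∉ S → x i = 0 := by
  simp [X, Submodule.mem_iInf]

lemma finrank_X {ι : Type*} [Fintype ι] [DecidableEq ι] (S : Finset ι) :
    finrank K (X K (S : Set ι)) = S.card := by
  have e := LinearMap.iInfKerProjEquiv K (fun _ : ι => K) (I := (S : Set ι)) (J := (S : Set ι)ᶜ)
    disjoint_compl_right (by simp)
  have := e.finrank_eq
  rw [X, this]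
  simp

def c (l : K) (i : Fin 3) : K := if i = 2 then l else 1

def B (l : K) (i : Fin 3) : Submodule K (Fin 3 → K) :=
  LinearMap.ker ((LinearMap.proj (i+1) : (Fin 3 → K) →ₗ[K] K) - c l i • LinearMap.proj (i+2))

lemma mem_B {l : K} {i : Fin 3} {x : Fin 3 → K} : x ∈ B l i ↔ x (i+1) = c l i * x (i+2) := by
  simp [B, sub_eq_zero]

lemma finrank_B (l : K) (i : Fin 3) : finrank K (B l i) = 2 := by
  set f := ((LinearMap.proj (i+1) : (Fin 3 → K) →ₗ[K] K) - c l i • LinearMap.proj (i+2)) with hf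
  have h1 : f ≠ 0 := by
    intro h
    have := LinearMap.congr_fun h (Pi.single (i+1) 1)
    revert this
    fin_cases i <;> simp [hf, Pi.single_apply]
  have h2 := Module.Dual.finrank_ker_add_one_of_ne_zero (f := f) h1
  simp at h2
  have : B l i = LinearMap.ker f := rfl
  rw [this]; omega

lemma A_le_B (l : K) (i : Fin 3) : X K {i} ≤ B l i := by
  intro x hx
  rw [mem_X] at hx
  rw [mem_B, hx, hx] <;> fin_cases i <;> simp

lemma scalar {l m : K} (f : (Fin 3 → K) →ₗ[K] (Fin 3 → K))
    (hA : ∀ i, ∀ x ∈ X K {i}, f x ∈ X K {i}) (hB : ∀ i, ∀ x ∈ B l i, f x ∈ B m i) :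
    ∃ a : K, (∀ x, f x = a • x) ∧ a * l = a * m := by
  have h : ∀ i j, j ≠ i → f (Pi.single i 1) j = 0 := by
    intro i j hj
    exact mem_X.1 (hA i (Pi.single i 1) (mem_X.2 (by simp +contextual [Pi.single_apply]))) j
      (by simpa using hj)
  have hx : ∀ x i, f x i = x i * f (Pi.single i 1) i := by
    intro x i
    conv_lhs => rw [LinearMap.pi_apply_eq_sum_univ f x]
    have e : ∀ k : Fin 3, (fun j => if k = j then (1:K) else 0) = Pi.single k 1 := by
      intro k; ext j; simp [Pi.single_apply, eq_comm]
    simp only [e, Finset.sum_apply, Pi.smul_apply, smul_eq_mul]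
    rw [Finset.sum_eq_single i]
    · intro b _ hb
      rw [h b i hb.symm, mul_zero]
    · simp
  have b0 := mem_B.1 (hB 0 ![0,1,1] (mem_B.2 (by simp [c])))
  have b1 := mem_B.1 (hB 1 ![1,0,1] (mem_B.2 (by simp [c])))
  have b2 := mem_B.1 (hB 2 ![l,1,0] (mem_B.2 (by simp [c])))
  rw [hx, hx ![0,1,1] (0+2)] at b0
  rw [hx, hx ![1,0,1] (1+2)] at b1
  rw [hx, hx ![l,1,0] (2+2)] at b2
  simp [c] at b0 b1 b2
  refine ⟨f (Pi.single 0 1) 0, ?_, ?_⟩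
  · intro x
    ext i
    rw [hx]
    have h2 : ∀ i, f (Pi.single i 1) i = f (Pi.single 0 1) 0 := by
      intro i
      fin_cases i
      · rfl
      · exact b0.trans b1
      · exact b1
    rw [h2, Pi.smul_apply, smul_eq_mul, mul_comm]
  · rw [b0, b1] at b2
    linear_combination b2

def cU (K : Type*) [Field K] {m : ℕ} (S : Fin 3 → Finset (Fin m)) (i : Fin 3) :
    Submodule K ((Fin 3 → K) × (Fin m → K)) :=
  (X K {i}).prod (X K (S i : Set (Fin m)))

def cV {m : ℕ} (T : Fin 3 → Finset (Fin m)) (l : K) (i : Fin 3) :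
    Submodule K ((Fin 3 → K) × (Fin m → K)) :=
  (B l i).prod (X K (T i : Set (Fin m)))

lemma key {m : ℕ} (S T : Fin 3 → Finset (Fin m)) (l l' : K)
    (g h : ((Fin 3 → K) × (Fin m → K)) →ₗ[K] ((Fin 3 → K) × (Fin m → K)))
    (hgh : ∀ x, h (g x) = x)
    (gU : ∀ i, ∀ x ∈ cU K S i, g x ∈ cU K S i) (gV : ∀ i, ∀ x ∈ cV T l i, g x ∈ cV T l' i)
    (hU : ∀ i, ∀ x ∈ cU K S i, h x ∈ cU K S i) (hV : ∀ i, ∀ x ∈ cV T l' i, h x ∈ cV T l i) :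
    l = l' := by
  by_contra hne
  obtain ⟨a, ha, hal⟩ := scalar (l := l) (m := l')
    (LinearMap.fst K _ _ ∘ₗ g ∘ₗ LinearMap.inl K _ _)
    (fun i x hx => (gU i (x, 0) ⟨hx, Submodule.zero_mem _⟩).1)
    (fun i x hx => (gV i (x, 0) ⟨hx, Submodule.zero_mem _⟩).1)
  have a0 : a = 0 := by
    by_contra h0
    exact hne (mul_left_cancel₀ h0 hal)
  have hg0 : ∀ w, (g (w, 0)).1 = 0 := by
    intro w
    have := ha w
    simpa [a0] using this
  have step : ∀ (P Q : Submodule K (Fin 3 → K)) (R : Finset (Fin m)),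
      (∀ x ∈ P.prod (X K (R : Set (Fin m))), g x ∈ Q.prod (X K (R : Set (Fin m)))) →
      (∀ x ∈ Q.prod (X K (R : Set (Fin m))), h x ∈ P.prod (X K (R : Set (Fin m)))) →
      ∀ j, ∀ x ∈ P, (g (x, 0)).2 j • (h (0, Pi.single j 1)).1 ∈ P := by
    intro P Q R h1 h2 j x hx
    by_cases hj : j ∈ R
    · refine P.smul_mem _ (h2 _ ⟨Q.zero_mem, mem_X.2 ?_⟩).1
      intro k hk
      have : k ≠ j := by rintro rfl; exact hk (by simpa using hj)
      simp [this]
    · have := mem_X.1 (h1 (x, 0) ⟨hx, Submodule.zero_mem _⟩).2 j (by simpa using hj)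
      rw [this, zero_smul]
      exact P.zero_mem
  have hz : ∀ j w, (g (w, 0)).2 j • (h (0, Pi.single j 1)).1 = 0 := by
    intro j
    set p := (h (0, Pi.single j 1)).1 with hp
    obtain ⟨b, hb, -⟩ := scalar (l := l) (m := l)
      ((LinearMap.proj j ∘ₗ LinearMap.snd K _ _ ∘ₗ g ∘ₗ LinearMap.inl K _ _).smulRight p)
      (fun i x hx => step _ _ (S i) (gU i) (hU i) j x hx)
      (fun i x hx => step _ _ (T i) (gV i) (hV i) j x hx)
    simp only [LinearMap.smulRight_apply, LinearMap.comp_apply, LinearMap.inl_apply,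
      LinearMap.snd_apply, LinearMap.proj_apply] at hb
    have e00 := congrFun (hb (Pi.single 0 1)) 0
    have e10 := congrFun (hb (Pi.single 1 1)) 0
    have e11 := congrFun (hb (Pi.single 1 1)) 1
    simp at e00 e10 e11
    have b0 : b = 0 := by
      rcases e10 with h | h
      · rw [← e11, h, zero_mul]
      · rw [← e00, h, mul_zero]
    intro w
    rw [hb, b0, zero_smul]
  have hw : ∀ w : Fin 3 → K, w = 0 := by
    intro w
    have h1 : g (w, 0) = ∑ j, (g (w, 0)).2 j • ((0 : Fin 3 → K), (Pi.single j 1 : Fin m → K)) := by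
      refine Prod.ext ?_ ?_
      · simp [hg0, Prod.fst_sum]
      · ext k
        simp [Prod.snd_sum, Finset.sum_apply, Pi.single_apply]
    have h2 := congrArg Prod.fst (hgh (w, 0))
    rw [h1, map_sum, Prod.fst_sum] at h2
    simp only [map_smul, Prod.smul_fst, hz, Finset.sum_const_zero] at h2
    exact h2.symm
  have := congrFun (hw (fun _ => 1)) 0
  simp at this

lemma finrank_sprod {M N : Type*} [AddCommGroup M] [Module K M] [AddCommGroup N] [Module K N]
    [FiniteDimensional K M] [FiniteDimensional K N] (P : Submodule K M) (Q : Submodule K N) :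
    finrank K (P.prod Q) = finrank K P + finrank K Q := by
  let e : (P.prod Q) ≃ₗ[K] P × Q :=
    { toFun := fun x => (⟨x.1.1, x.2.1⟩, ⟨x.1.2, x.2.2⟩)
      invFun := fun y => ⟨(y.1.1, y.2.1), ⟨y.1.2, y.2.2⟩⟩
      map_add' := fun _ _ => rfl
      map_smul' := fun _ _ => rfl
      left_inv := fun _ => rfl
      right_inv := fun _ => rfl }
  rw [e.finrank_eq, finrank_prod]

end FlagAux

open FlagAux in
/-- GL(V) has infinitely many orbits on configurations of three two-step flags
`U_i ⊆ V_i` of proper nonzero subspaces. -/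
theorem infinitely_many_orbits_three_two_step_flags
    (K : Type*) [Field K] [IsAlgClosed K] (V : Type*) [AddCommGroup V] [Module K V]
    [FiniteDimensional K V] (n : ℕ) (hn : finrank K V = n)
    (u v : Fin 3 → ℕ) (hu0 : ∀ i, 0 < u i) (huv : ∀ i, u i < v i) (hvn : ∀ i, v i < n) :
    { O : Set ((Fin 3 → Submodule K V) × (Fin 3 → Submodule K V)) |
        ∃ c : (Fin 3 → Submodule K V) × (Fin 3 → Submodule K V),
          ((∀ i, c.1 i ≤ c.2 i) ∧
            (∀ i, finrank K (c.1 i) = u i) ∧ (∀ i, finrank K (c.2 i) = v i)) ∧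
          O = { c' | ∃ g : V ≃ₗ[K] V,
            ∀ i, (c.1 i).map g.toLinearMap = c'.1 i ∧
              (c.2 i).map g.toLinearMap = c'.2 i } }.Infinite := by
  have hn3 : 3 ≤ n := by have := hu0 0; have := huv 0; have := hvn 0; omega
  obtain ⟨m, rfl⟩ := Nat.exists_eq_add_of_le hn3
  have hT : ∀ i, ∃ T : Finset (Fin m), T.card = v i - 2 := fun i => by
    obtain ⟨T, -, hT⟩ := Finset.exists_subset_card_eq (s := (Finset.univ : Finset (Fin m)))
      (n := v i - 2) (by have := hvn i; simp; omega)
    exact ⟨T, hT⟩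
  choose T hT using hT
  have hS : ∀ i, ∃ S : Finset (Fin m), S ⊆ T i ∧ S.card = u i - 1 := fun i =>
    Finset.exists_subset_card_eq (by rw [hT]; have := huv i; omega)
  choose S hST hS using hS
  let e : ((Fin 3 → K) × (Fin m → K)) ≃ₗ[K] V := LinearEquiv.ofFinrankEq _ _ (by simp [hn])
  have : Infinite K := IsAlgClosed.instInfinite
  let cf : K → (Fin 3 → Submodule K V) × (Fin 3 → Submodule K V) := fun l =>
    (fun i => (cU K S i).map e.toLinearMap, fun i => (cV T l i).map e.toLinearMap)
  refine Set.infinite_of_injective_forall_mem (f := fun l : K =>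
    { c' : (Fin 3 → Submodule K V) × (Fin 3 → Submodule K V) | ∃ g : V ≃ₗ[K] V,
            ∀ i, ((cf l).1 i).map g.toLinearMap = c'.1 i ∧
              ((cf l).2 i).map g.toLinearMap = c'.2 i }) ?_ ?_
  · intro l l' hll
    have hm : cf l' ∈ { c' : (Fin 3 → Submodule K V) × (Fin 3 → Submodule K V) |
        ∃ g : V ≃ₗ[K] V, ∀ i, ((cf l').1 i).map g.toLinearMap = c'.1 i ∧
              ((cf l').2 i).map g.toLinearMap = c'.2 i } :=
      ⟨LinearEquiv.refl K V, fun i => by constructor <;> exact Submodule.map_id _⟩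
    have hm2 := (Set.ext_iff.1 hll (cf l')).2 hm
    obtain ⟨g, hg⟩ := hm2
    have fwd : ∀ P Q : Submodule K ((Fin 3 → K) × (Fin m → K)),
        (P.map e.toLinearMap).map g.toLinearMap = Q.map e.toLinearMap →
        (∀ x ∈ P, e.symm (g (e x)) ∈ Q) ∧ (∀ x ∈ Q, e.symm (g.symm (e x)) ∈ P) := by
      intro P Q hPQ
      constructor
      · intro x hx
        have : g (e x) ∈ Q.map e.toLinearMap := by
          rw [← hPQ]
          exact Submodule.mem_map_of_mem (f := g.toLinearMap)
            (Submodule.mem_map_of_mem (f := e.toLinearMap) hx)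
        obtain ⟨y, hy, hye⟩ := this
        have hye : e y = g (e x) := hye
        rw [← hye]; simpa using hy
      · intro x hx
        have : e x ∈ (P.map e.toLinearMap).map g.toLinearMap := by
          rw [hPQ]
          exact Submodule.mem_map_of_mem (f := e.toLinearMap) hx
        obtain ⟨_, ⟨y, hy, rfl⟩, hye⟩ := this
        have hye : g (e y) = e x := hye
        rw [← hye]; simpa using hy
    exact key S T l l' (e.trans (g.trans e.symm)).toLinearMap
      (e.trans (g.symm.trans e.symm)).toLinearMap (fun x => by simp)
      (fun i => (fwd _ _ (hg i).1).1) (fun i => (fwd _ _ (hg i).2).1)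
      (fun i => (fwd _ _ (hg i).1).2) (fun i => (fwd _ _ (hg i).2).2)
  · intro l
    refine ⟨cf l, ⟨?_, ?_, ?_⟩, rfl⟩
    · intro i
      refine Submodule.map_mono (Submodule.prod_mono (A_le_B l i) ?_)
      intro x hx
      rw [mem_X] at hx ⊢
      exact fun j hj => hx j (fun h => hj (hST i h))
    · intro i
      have h1 := finrank_X (K := K) ({i} : Finset (Fin 3))
      rw [Finset.coe_singleton, Finset.card_singleton] at h1
      have := hu0 i
      change finrank K ((cU K S i).map e.toLinearMap) = _
      rw [LinearEquiv.finrank_map_eq, cU, finrank_sprod, finrank_X, hS, h1]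
      omega
    · intro i
      have := hu0 i
      have := huv i
      change finrank K ((cV T l i).map e.toLinearMap) = _
      rw [LinearEquiv.finrank_map_eq, cV, finrank_sprod, finrank_X, hT, finrank_B]
      omega
end

section
/- Let K be an algebraically closed field and V a K-vector space of dimension n. Fix integers 0 < u_1 < u_2 < u_3 < n, 0 < v_1 < v_2 < v_3 < n, and y with 2 ≤ y ≤ n − 2. Then the GL(V)-action on configurations (U_1 ⊆ U_2 ⊆ U_3, V_1 ⊆ V_2 ⊆ V_3, Y) of seven subspaces of V with dim U_i = u_i, dim V_i = v_i and dim Y = y has infinitely many orbits. -/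
open Module

/-- Vectors supported on a set of coordinates. -/
def coordSub (K : Type*) [Field K] {ι : Type*} (p : ι → Prop) : Submodule K (ι → K) where
  carrier := {x | ∀ j, ¬ p j → x j = 0}
  add_mem' := by
    intro a b ha hb j hj
    simp [ha j hj, hb j hj]
  zero_mem' := by
    intro j _
    rfl
  smul_mem' := by
    intro c x hx j hj
    simp [hx j hj]

theorem mem_coordSub {K : Type*} [Field K] {ι : Type*} {p : ι → Prop} {x : ι → K} :
    x ∈ coordSub K p ↔ ∀ j, ¬ p j → x j = 0 := Iff.rfl

theorem finrank_coordSub (K : Type*) [Field K] {ι : Type*} [Fintype ι] (p : ι → Prop)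
    [DecidablePred p] : finrank K (coordSub K p) = Fintype.card {j // p j} := by
  have e : coordSub K p ≃ₗ[K] ({j // p j} → K) :=
    { toFun := fun x j => x.1 j.1
      map_add' := fun _ _ => rfl
      map_smul' := fun _ _ => rfl
      invFun := fun f => ⟨fun j => if h : p j then f ⟨j, h⟩ else 0, by
        intro j hj
        simp [hj]⟩
      left_inv := by
        intro x
        ext j
        by_cases h : p j
        · simp [h]
        · simp [h, x.2 j h]
      right_inv := by
        intro f
        ext j
        simp [j.2] }
  rw [e.finrank_eq, finrank_pi]

theorem finrank_coordSub_lt (K : Type*) [Field K] (m a : ℕ) (h : a ≤ m) :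
    finrank K (coordSub K (fun j : Fin m => j.1 < a)) = a := by
  rw [finrank_coordSub, Fintype.card_subtype]
  rw [Fin.card_filter_val_lt, min_eq_right h]

theorem finrank_sprod {K : Type*} [Field K] {A B : Type*} [AddCommGroup A] [Module K A]
    [AddCommGroup B] [Module K B] [FiniteDimensional K A] [FiniteDimensional K B]
    (p : Submodule K A) (q : Submodule K B) :
    finrank K (p.prod q) = finrank K p + finrank K q := by
  have e : p.prod q ≃ₗ[K] p × q :=
    { toFun := fun x => (⟨x.1.1, x.2.1⟩, ⟨x.1.2, x.2.2⟩)
      map_add' := fun _ _ => rfl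
      map_smul' := fun _ _ => rfl
      invFun := fun x => ⟨(x.1.1, x.2.1), x.1.2, x.2.2⟩
      left_inv := fun _ => rfl
      right_inv := fun _ => rfl }
  rw [e.finrank_eq, finrank_prod]

/-- The generic plane. -/
def planeY {K : Type*} [Field K] (l : K) : Submodule K (Fin 4 → K) where
  carrier := {x | x 2 = x 0 + x 1 ∧ x 3 = x 0 + l * x 1}
  add_mem' := by
    rintro a b ⟨h1, h2⟩ ⟨h3, h4⟩
    constructor
    · simp only [Pi.add_apply, h1, h3]; ring
    · simp only [Pi.add_apply, h2, h4]; ring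
  zero_mem' := by simp
  smul_mem' := by
    rintro c x ⟨h1, h2⟩
    constructor
    · simp only [Pi.smul_apply, smul_eq_mul, h1]; ring
    · simp only [Pi.smul_apply, smul_eq_mul, h2]; ring

theorem mem_planeY {K : Type*} [Field K] {l : K} {x : Fin 4 → K} :
    x ∈ planeY l ↔ x 2 = x 0 + x 1 ∧ x 3 = x 0 + l * x 1 := Iff.rfl

theorem finrank_planeY {K : Type*} [Field K] (l : K) : finrank K (planeY l) = 2 := by
  have e : planeY l ≃ₗ[K] (Fin 2 → K) :=
    { toFun := fun x => ![x.1 0, x.1 1]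
      map_add' := by
        intro x y
        ext j; fin_cases j <;> simp
      map_smul' := by
        intro x y
        ext j; fin_cases j <;> simp
      invFun := fun f => ⟨![f 0, f 1, f 0 + f 1, f 0 + l * f 1], by simp [mem_planeY]⟩
      left_inv := by
        rintro ⟨x, h1, h2⟩
        ext j; fin_cases j <;> simp [h1, h2]
      right_inv := by
        intro f
        ext j; fin_cases j <;> simp }
  rw [e.finrank_eq]; simp

/-- The two opposite flags in dimension four. -/
def flagU (K : Type*) [Field K] (i : Fin 3) : Submodule K (Fin 4 → K) :=
  coordSub K (fun j => j.1 < i.1 + 1)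

def flagV (K : Type*) [Field K] (i : Fin 3) : Submodule K (Fin 4 → K) :=
  coordSub K (fun j => 3 - i.1 ≤ j.1)

theorem hom_scalar {K : Type*} [Field K] (l m : K) (f : (Fin 4 → K) →ₗ[K] (Fin 4 → K))
    (hU : ∀ i, ∀ x ∈ flagU K i, f x ∈ flagU K i)
    (hV : ∀ i, ∀ x ∈ flagV K i, f x ∈ flagV K i)
    (hY : ∀ x ∈ planeY l, f x ∈ planeY m) :
    ∃ d : K, (∀ x, f x = d • x) ∧ (l ≠ m → d = 0) := by
  have key : ∀ j k : Fin 4, j ≠ k → f (Pi.single j 1) k = 0 := by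
    intro j k hjk
    rcases lt_or_gt_of_ne hjk with h | h
    · have hj : j.1 < 3 := by omega
      refine hU ⟨j.1, hj⟩ (Pi.single j 1) ?_ k ?_
      · intro t ht
        apply Pi.single_eq_of_ne
        rintro rfl
        simp at ht
      · simp; omega
    · refine hV ⟨3 - j.1, by omega⟩ (Pi.single j 1) ?_ k ?_
      · intro t ht
        apply Pi.single_eq_of_ne
        rintro rfl
        apply ht
        simp; omega
      · simp; omega
  have diag : ∀ x k, f x k = f (Pi.single k 1) k * x k := by
    intro x k
    have hx : x = ∑ j, x j • (Pi.single j (1 : K) : Fin 4 → K) := by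
      ext t; simp [Finset.sum_apply, Pi.single_apply]
    conv_lhs => rw [hx]
    rw [map_sum, Finset.sum_apply, Finset.sum_eq_single k]
    · simp [mul_comm]
    · intro j _ hj
      simp [key j k hj]
    · simp
  generalize hd : (fun k => f (Pi.single k 1) k) = d at *
  have diag : ∀ x k, f x k = d k * x k := by
    intro x k
    rw [diag, ← hd]
  have h1 := hY ![1, 0, 1, 1] (by simp [mem_planeY])
  have h2 := hY ![0, 1, 1, l] (by simp [mem_planeY])
  rw [mem_planeY] at h1 h2
  simp only [diag] at h1 h2
  simp at h1 h2
  obtain ⟨a1, a2⟩ := h1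
  obtain ⟨a3, a4⟩ := h2
  refine ⟨d 0, ?_, ?_⟩
  · intro x
    ext k
    rw [diag, Pi.smul_apply, smul_eq_mul]
    have b1 : d 1 = d 0 := by rw [← a3, a1]
    fin_cases k
    · rfl
    · exact congrArg (· * x 1) b1
    · exact congrArg (· * x 2) a1
    · exact congrArg (· * x 3) a2
  · intro hlm
    by_contra h0
    apply hlm
    have : d 1 = d 0 := by rw [← a3, a1]
    rw [a2, this, mul_comm m] at a4
    exact mul_left_cancel₀ h0 a4

/-- The full space. -/
abbrev XX (K : Type*) (m : ℕ) := (Fin 4 → K) × (Fin m → K)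

theorem no_iso {K : Type*} [Field K] (m : ℕ) (a b : Fin 3 → ℕ) (c : ℕ) (l l' : K)
    (g : XX K m ≃ₗ[K] XX K m)
    (hU : ∀ i, ∀ x, x ∈ (flagU K i).prod (coordSub K (fun j : Fin m => j.1 < a i)) ↔
      g x ∈ (flagU K i).prod (coordSub K (fun j : Fin m => j.1 < a i)))
    (hV : ∀ i, ∀ x, x ∈ (flagV K i).prod (coordSub K (fun j : Fin m => j.1 < b i)) ↔
      g x ∈ (flagV K i).prod (coordSub K (fun j : Fin m => j.1 < b i)))
    (hY : ∀ x, x ∈ (planeY l).prod (coordSub K (fun j : Fin m => j.1 < c)) ↔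
      g x ∈ (planeY l').prod (coordSub K (fun j : Fin m => j.1 < c))) : l = l' := by
  by_contra hne
  have hz : ∀ p : Fin m → Prop, (0 : Fin m → K) ∈ coordSub K p := fun p => zero_mem _
  have A : ∀ x : Fin 4 → K, (g (x, 0)).1 = 0 := by
    obtain ⟨d, h1, h2⟩ := hom_scalar l l'
      (LinearMap.fst K _ _ ∘ₗ g.toLinearMap ∘ₗ LinearMap.inl K (Fin 4 → K) (Fin m → K))
      (fun i x hx => ((hU i (x, 0)).1 ⟨hx, hz _⟩).1)
      (fun i x hx => ((hV i (x, 0)).1 ⟨hx, hz _⟩).1)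
      (fun x hx => ((hY (x, 0)).1 ⟨hx, hz _⟩).1)
    intro x
    have := h1 x
    rw [h2 hne, zero_smul] at this
    exact this
  have S : ∀ (p : Fin m → Prop) (k : Fin m) (w : Fin m → K), w ∈ coordSub K p →
      (Pi.single k (w k) : Fin m → K) ∈ coordSub K p := by
    intro p k w hw j hj
    by_cases h : j = k
    · subst h
      simp [hw j hj]
    · exact Pi.single_eq_of_ne h _
  have B : ∀ (k : Fin m) (x : Fin 4 → K),
      (g.symm (0, Pi.single k ((g (x, 0)).2 k))).1 = 0 := by
    intro k
    obtain ⟨d, h1, -⟩ := hom_scalar l l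
      (LinearMap.fst K _ _ ∘ₗ g.symm.toLinearMap ∘ₗ LinearMap.inr K (Fin 4 → K) (Fin m → K) ∘ₗ
        LinearMap.single K (fun _ : Fin m => K) k ∘ₗ LinearMap.proj k ∘ₗ LinearMap.snd K _ _ ∘ₗ
        g.toLinearMap ∘ₗ LinearMap.inl K (Fin 4 → K) (Fin m → K))
      (fun i x hx => by
        have := ((hU i (x, 0)).1 ⟨hx, hz _⟩).2
        refine ((hU i (g.symm (0, Pi.single k ((g (x, 0)).2 k)))).2 ?_).1
        rw [g.apply_symm_apply]
        exact ⟨zero_mem _, S _ _ _ this⟩)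
      (fun i x hx => by
        have := ((hV i (x, 0)).1 ⟨hx, hz _⟩).2
        refine ((hV i (g.symm (0, Pi.single k ((g (x, 0)).2 k)))).2 ?_).1
        rw [g.apply_symm_apply]
        exact ⟨zero_mem _, S _ _ _ this⟩)
      (fun x hx => by
        have := ((hY (x, 0)).1 ⟨hx, hz _⟩).2
        refine ((hY (g.symm (0, Pi.single k ((g (x, 0)).2 k)))).2 ?_).1
        rw [g.apply_symm_apply]
        exact ⟨zero_mem _, S _ _ _ this⟩)
    have h1 : ∀ x : Fin 4 → K, (g.symm (0, Pi.single k ((g (x, 0)).2 k))).1 = d • x := h1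
    have h3 : ∀ x : Fin 4 → K, (g.symm (0, Pi.single k ((g (x, 0)).2 k))).1
        = (g (x, 0)).2 k • (g.symm (0, Pi.single k 1)).1 := by
      intro x
      rw [← Prod.smul_fst, ← map_smul, Prod.smul_mk, smul_zero, ← Pi.single_smul, smul_eq_mul,
        mul_one]
    suffices hd : d = 0 by
      intro x
      rw [h1, hd, zero_smul]
    by_contra hd
    generalize (g.symm (0, Pi.single k 1)).1 = w at h3
    have e0 : ∀ x t, (g (x, 0)).2 k * w t = d * x t := by
      intro x t
      have := congrFun ((h3 x).symm.trans (h1 x)) t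
      simpa using this
    have q1 := e0 (Pi.single 0 1) 0
    have q2 := e0 (Pi.single 0 1) 1
    have q3 := e0 (Pi.single 1 1) 1
    simp at q1 q2 q3
    rcases q2 with q2 | q2
    · rw [q2, zero_mul] at q1
      exact hd q1.symm
    · rw [q2, mul_zero] at q3
      exact hd q3.symm
  have C : ∀ x : Fin 4 → K, x = 0 := by
    intro x
    have e1 : g (x, 0) = ∑ k, ((0, Pi.single k ((g (x, 0)).2 k)) : XX K m) := by
      ext t
      · rw [A x]; simp [Prod.fst_sum]
      · rw [Prod.snd_sum]; simp [Finset.sum_apply, Pi.single_apply]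
    have e2 := congrArg (fun z => (g.symm z).1) e1
    simp only [LinearEquiv.symm_apply_apply, map_sum, Prod.fst_sum, B] at e2
    simpa using e2
  have := congrFun (C (fun _ => 1)) 0
  simp at this

/-- GL(V) has infinitely many orbits on configurations of two three-step flags together
with a subspace `Y` of dimension `y` with `2 ≤ y ≤ n - 2`. -/
theorem infinitely_many_orbits_two_three_step_flags_and_subspace
    (K : Type*) [Field K] [IsAlgClosed K] (V : Type*) [AddCommGroup V] [Module K V]
    [FiniteDimensional K V] (n y : ℕ) (hn : finrank K V = n)
    (u v : Fin 3 → ℕ) (hu : StrictMono u) (hv : StrictMono v)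
    (hu0 : 0 < u 0) (hun : u 2 < n) (hv0 : 0 < v 0) (hvn : v 2 < n)
    (hy2 : 2 ≤ y) (hyn : y + 2 ≤ n) :
    { O : Set ((Fin 3 → Submodule K V) × (Fin 3 → Submodule K V) × Submodule K V) |
        ∃ c : (Fin 3 → Submodule K V) × (Fin 3 → Submodule K V) × Submodule K V,
          (Monotone c.1 ∧ Monotone c.2.1 ∧
            (∀ i, finrank K (c.1 i) = u i) ∧ (∀ i, finrank K (c.2.1 i) = v i) ∧
            finrank K c.2.2 = y) ∧
          O = { c' | ∃ g : V ≃ₗ[K] V,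
            (∀ i, (c.1 i).map g.toLinearMap = c'.1 i) ∧
            (∀ i, (c.2.1 i).map g.toLinearMap = c'.2.1 i) ∧
            c.2.2.map g.toLinearMap = c'.2.2 } }.Infinite := by
  classical
  have u01 : u 0 < u 1 := hu (by decide)
  have u12 : u 1 < u 2 := hu (by decide)
  have v01 : v 0 < v 1 := hv (by decide)
  have v12 : v 1 < v 2 := hv (by decide)
  obtain ⟨m, rfl⟩ : ∃ m, n = 4 + m := ⟨n - 4, by omega⟩
  let a : Fin 3 → ℕ := fun i => u i - (i.1 + 1)
  let b : Fin 3 → ℕ := fun i => v i - (i.1 + 1)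
  have ha : ∀ i, i.1 + 1 + a i = u i ∧ a i ≤ m := by
    intro i; fin_cases i <;> simp [a] <;> omega
  have hb : ∀ i, i.1 + 1 + b i = v i ∧ b i ≤ m := by
    intro i; fin_cases i <;> simp [b] <;> omega
  have ham : Monotone a := by
    intro i j hij
    fin_cases i <;> fin_cases j <;> simp [a] at hij ⊢ <;> omega
  have hbm : Monotone b := by
    intro i j hij
    fin_cases i <;> fin_cases j <;> simp [b] at hij ⊢ <;> omega
  have e : XX K m ≃ₗ[K] V := LinearEquiv.ofFinrankEq _ _ (by rw [hn, finrank_prod]; simp)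
  let PU : Fin 3 → Submodule K (XX K m) := fun i =>
    (flagU K i).prod (coordSub K (fun j : Fin m => j.1 < a i))
  let PV : Fin 3 → Submodule K (XX K m) := fun i =>
    (flagV K i).prod (coordSub K (fun j : Fin m => j.1 < b i))
  let PY : K → Submodule K (XX K m) := fun l =>
    (planeY l).prod (coordSub K (fun j : Fin m => j.1 < y - 2))
  let cc : K → (Fin 3 → Submodule K V) × (Fin 3 → Submodule K V) × Submodule K V := fun l =>
    (fun i => (PU i).map e.toLinearMap, fun i => (PV i).map e.toLinearMap,
      (PY l).map e.toLinearMap)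
  have T : ∀ (P Q : Submodule K (XX K m)) (g : V ≃ₗ[K] V),
      (P.map e.toLinearMap).map g.toLinearMap = Q.map e.toLinearMap →
      ∀ x, x ∈ P ↔ (e.trans (g.trans e.symm)) x ∈ Q := by
    intro P Q g h x
    have h1 : x ∈ P ↔ g (e x) ∈ (P.map e.toLinearMap).map g.toLinearMap := by
      simp
    rw [h1, h]
    simp only [LinearEquiv.trans_apply]
    constructor
    · rintro ⟨z, hz, hz'⟩
      rw [← hz']
      simpa using hz
    · intro hz
      exact ⟨_, hz, by simp⟩
  refine Set.infinite_of_injective_forall_mem (α := K)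
    (f := fun l => { c' | ∃ g : V ≃ₗ[K] V,
            (∀ i, ((cc l).1 i).map g.toLinearMap = c'.1 i) ∧
            (∀ i, ((cc l).2.1 i).map g.toLinearMap = c'.2.1 i) ∧
            (cc l).2.2.map g.toLinearMap = c'.2.2 }) ?_ ?_
  · intro l l' h
    have hm : cc l' ∈ { c' | ∃ g : V ≃ₗ[K] V,
            (∀ i, ((cc l).1 i).map g.toLinearMap = c'.1 i) ∧
            (∀ i, ((cc l).2.1 i).map g.toLinearMap = c'.2.1 i) ∧
            (cc l).2.2.map g.toLinearMap = c'.2.2 } := by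
      refine (Set.ext_iff.1 h (cc l')).2 ?_
      refine ⟨LinearEquiv.refl K V, fun i => ?_, fun i => ?_, ?_⟩ <;>
        exact Submodule.map_id _
    obtain ⟨g, g1, g2, g3⟩ := hm
    exact no_iso m a b (y - 2) l l' (e.trans (g.trans e.symm))
      (fun i => T _ _ g (g1 i)) (fun i => T _ _ g (g2 i)) (T _ _ g g3)
  · intro l
    refine ⟨cc l, ⟨?_, ?_, ?_, ?_, ?_⟩, rfl⟩
    · intro i j hij
      refine Submodule.map_mono (Submodule.prod_mono ?_ ?_)
      · intro x hx k hk
        have : i.1 ≤ j.1 := hij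
        exact hx k (by omega)
      · intro x hx k hk
        have := ham hij
        exact hx k (by omega)
    · intro i j hij
      refine Submodule.map_mono (Submodule.prod_mono ?_ ?_)
      · intro x hx k hk
        have : i.1 ≤ j.1 := hij
        exact hx k (by omega)
      · intro x hx k hk
        have := hbm hij
        exact hx k (by omega)
    · intro i
      have h1 : finrank K ((PU i).map e.toLinearMap) = finrank K (PU i) :=
        LinearEquiv.finrank_map_eq e _
      refine h1.trans ?_
      rw [finrank_sprod, finrank_coordSub_lt _ _ _ (ha i).2, flagU,
        finrank_coordSub_lt _ _ _ (by omega), (ha i).1]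
    · intro i
      have h1 : finrank K ((PV i).map e.toLinearMap) = finrank K (PV i) :=
        LinearEquiv.finrank_map_eq e _
      refine h1.trans ?_
      have h2 : finrank K (flagV K i) = i.1 + 1 := by
        rw [flagV, finrank_coordSub]
        fin_cases i <;> rfl
      rw [finrank_sprod, finrank_coordSub_lt _ _ _ (hb i).2, h2, (hb i).1]
    · have h1 : finrank K ((PY l).map e.toLinearMap) = finrank K (PY l) :=
        LinearEquiv.finrank_map_eq e _
      refine h1.trans ?_
      rw [finrank_sprod, finrank_coordSub_lt _ _ _ (by omega), finrank_planeY]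
      omega
end

section
/- Let K be an algebraically closed field and V a K-vector space of dimension n. Fix integers 0 < d_1 ≤ d_2 ≤ d_3 ≤ d_4 < n. Then the GL(V)-action on quadruples (U_1, U_2, U_3, U_4) of subspaces of V with dim U_i = d_i has infinitely many orbits. -/
open Module

def auxProd {K A B : Type*} [Field K] [AddCommGroup A] [Module K A] [AddCommGroup B] [Module K B]
    (p : Submodule K A) (q : Submodule K B) : (p.prod q) ≃ₗ[K] p × q where
  toFun x := (⟨x.1.1, x.2.1⟩, ⟨x.1.2, x.2.2⟩)
  invFun x := ⟨(x.1.1, x.2.1), ⟨x.1.2, x.2.2⟩⟩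
  map_add' _ _ := rfl
  map_smul' _ _ := rfl
  left_inv _ := rfl
  right_inv _ := rfl

theorem aux_flag (K : Type*) [Field K] (k m m' : ℕ) (hm : m ≤ m') (h : m' ≤ k) :
    ∃ W : ℕ → Submodule K (Fin k → K), (∀ i, i ≤ k → finrank K (W i) = i) ∧ W m ≤ W m' := by
  refine ⟨fun i => Submodule.span K ((Pi.basisFun K (Fin k)) '' {j | (j : ℕ) < i}), ?_, ?_⟩
  · intro i hi
    have hli := (Pi.basisFun K (Fin k)).linearIndependent.comp (Fin.castLE hi)
      (Fin.castLE_injective hi)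
    have h1 := finrank_span_eq_card hli
    have h2 : Set.range ((Pi.basisFun K (Fin k)) ∘ Fin.castLE hi)
        = (Pi.basisFun K (Fin k)) '' {j | (j : ℕ) < i} := by
      rw [Set.range_comp]
      congr 1
      ext j
      constructor
      · rintro ⟨x, rfl⟩
        simp
      · intro hj
        exact ⟨⟨j, hj⟩, rfl⟩
    rw [h2] at h1
    simpa using h1
  · apply Submodule.span_mono
    apply Set.image_mono
    intro j hj
    exact lt_of_lt_of_le hj hm

/-- GL(V) has infinitely many orbits on quadruples of proper nonzero subspaces of
fixed dimensions `0 < d₁ ≤ d₂ ≤ d₃ ≤ d₄ < n`. -/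
theorem infinitely_many_orbits_four_subspaces
    (K : Type*) [Field K] [IsAlgClosed K] (V : Type*) [AddCommGroup V] [Module K V]
    [FiniteDimensional K V] (n : ℕ) (hn : finrank K V = n)
    (d : Fin 4 → ℕ) (hd : Monotone d) (hd0 : 0 < d 0) (hdn : d 3 < n) :
    { O : Set (Fin 4 → Submodule K V) |
        ∃ c : Fin 4 → Submodule K V,
          (∀ i, finrank K (c i) = d i) ∧
          O = { c' | ∃ g : V ≃ₗ[K] V, ∀ i, (c i).map g.toLinearMap = c' i } }.Infinite := by
  have h01 : d 0 ≤ d 1 := hd (by decide)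
  have h0 : ∀ i, d 0 ≤ d i := fun i => hd (Fin.zero_le i)
  have h3 : ∀ i, d i ≤ d 3 := fun i => hd (Fin.le_last i)
  obtain ⟨W, hW, hW01⟩ := aux_flag K (n - 2) (d 0 - 1) (d 1 - 1) (by omega)
    (by have := h3 1; omega)
  have hfr : finrank K V = finrank K ((K × K) × (Fin (n - 2) → K)) := by
    have := h3 0
    simp [hn]
    omega
  let E : V ≃ₗ[K] (K × K) × (Fin (n - 2) → K) := LinearEquiv.ofFinrankEq _ _ hfr
  let v : K → Fin 4 → K × K := fun t => ![(1, 0), (0, 1), (1, 1), (1, t)]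
  have hv : ∀ t i, v t i ≠ 0 := by
    intro t i
    fin_cases i <;> simp [v]
  let c : K → Fin 4 → Submodule K V := fun t i =>
    ((Submodule.span K {v t i}).prod (W (d i - 1))).map E.symm.toLinearMap
  have hmem : ∀ t i x, x ∈ c t i ↔ (∃ a : K, a • v t i = (E x).1) ∧ (E x).2 ∈ W (d i - 1) := by
    intro t i x
    have : x ∈ c t i ↔ E x ∈ (Submodule.span K {v t i}).prod (W (d i - 1)) := by
      simp only [c]
      constructor
      · rintro ⟨y, hy, rfl⟩
        simpa using hy
      · intro hy
        exact ⟨E x, hy, by simp⟩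
    rw [this, Submodule.mem_prod, Submodule.mem_span_singleton]
  have hc : ∀ t i, finrank K (c t i) = d i := by
    intro t i
    have e1 : finrank K (c t i)
        = finrank K ((Submodule.span K {v t i}).prod (W (d i - 1))) :=
      LinearEquiv.finrank_map_eq E.symm _
    rw [e1, (auxProd _ _).finrank_eq, finrank_prod, finrank_span_singleton (hv t i),
      hW _ (by have := h3 i; omega)]
    have := h0 i
    omega
  refine Set.infinite_of_injective_forall_mem
    (f := fun t : K => { c' | ∃ g : V ≃ₗ[K] V, ∀ i, (c t i).map g.toLinearMap = c' i }) ?_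
    (fun t => ⟨c t, hc t, rfl⟩)
  intro t s hts
  have hs : c s ∈ { c' | ∃ g : V ≃ₗ[K] V, ∀ i, (c t i).map g.toLinearMap = c' i } := by
    have e := hts
    simp only at e
    rw [e]
    exact ⟨LinearEquiv.refl K V, fun i => Submodule.map_id _⟩
  obtain ⟨g, hg⟩ := hs
  have hgm : ∀ i x, x ∈ c t i ↔ g x ∈ c s i := by
    intro i x
    rw [← hg i]
    constructor
    · intro hx
      exact ⟨x, hx, rfl⟩
    · rintro ⟨y, hy, hxy⟩
      have : y = x := g.injective hxy
      exact this ▸ hy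
  let x : V := E.symm ((1, 0), 0)
  let y : V := E.symm ((0, 1), 0)
  obtain ⟨⟨a, ha⟩, hwa⟩ := (hmem s 0 _).1 ((hgm 0 x).1 ((hmem t 0 x).2 ⟨⟨1, by simp [v, x]⟩, by simp [x]⟩))
  obtain ⟨⟨b, hb⟩, hwb⟩ := (hmem s 1 _).1 ((hgm 1 y).1 ((hmem t 1 y).2 ⟨⟨1, by simp [v, y]⟩, by simp [y]⟩))
  obtain ⟨⟨p, hp⟩, -⟩ := (hmem s 2 _).1 ((hgm 2 (x + y)).1
    ((hmem t 2 _).2 ⟨⟨1, by simp [v, x, y]⟩, by simp [x, y]⟩))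
  obtain ⟨⟨q, hq⟩, -⟩ := (hmem s 3 _).1 ((hgm 3 (x + t • y)).1
    ((hmem t 3 _).2 ⟨⟨1, by simp [v, x, y]⟩, by simp [x, y]⟩))
  have ha0 : a ≠ 0 := by
    rintro rfl
    have h1 : g x ∈ c s 1 := (hmem s 1 _).2 ⟨⟨0, by rw [← ha]; simp⟩, hW01 hwa⟩
    obtain ⟨⟨r, hr⟩, -⟩ := (hmem t 1 x).1 ((hgm 1 x).2 h1)
    simp [v, x] at hr
  simp only [map_add, map_smul, Prod.fst_add, Prod.smul_fst, ← ha, ← hb] at hp hq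
  simp [v] at hp hq
  obtain ⟨hp1, hp2⟩ := hp
  obtain ⟨hq1, hq2⟩ := hq
  apply mul_left_cancel₀ ha0
  rw [← hp1, hp2, mul_comm, ← hq2, hq1, ← hp1, hp2]
end

section
/- Let n, k_1, k_2 be integers with 0 < k_1 < k_2 < n. Then 3·(k_1·(k_2 − k_1) + k_2·(n − k_2)) ≤ n², with equality if and only if n = 3·k_1 and k_2 = 2·k_1. -/
/-- For integers `0 < k₁ < k₂ < n`, three times the dimension of the two-step flag
variety `F(k₁,k₂;n)` is at most `n²`, with equality iff `n = 3k₁` and `k₂ = 2k₁`. -/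
theorem three_times_flag_dim_le_sq (n k1 k2 : ℤ)
    (h0 : 0 < k1) (h12 : k1 < k2) (h2n : k2 < n) :
    3 * (k1 * (k2 - k1) + k2 * (n - k2)) ≤ n ^ 2 ∧
      (3 * (k1 * (k2 - k1) + k2 * (n - k2)) = n ^ 2 ↔ n = 3 * k1 ∧ k2 = 2 * k1) := by
  have key : 4 * (n ^ 2 - 3 * (k1 * (k2 - k1) + k2 * (n - k2)))
      = (2 * n - 3 * k2) ^ 2 + 3 * (k2 - 2 * k1) ^ 2 := by ring
  have ha := sq_nonneg (2 * n - 3 * k2)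
  have hb := sq_nonneg (k2 - 2 * k1)
  refine ⟨by linarith, fun h => ?_, ?_⟩
  · have h1 : (2 * n - 3 * k2) ^ 2 = 0 := by linarith
    have h2 : (k2 - 2 * k1) ^ 2 = 0 := by linarith
    have h3 := pow_eq_zero_iff (two_ne_zero) |>.mp h1
    have h4 := pow_eq_zero_iff (two_ne_zero) |>.mp h2
    constructor <;> omega
  · rintro ⟨rfl, rfl⟩
    ring
end

section
/- Let K be an algebraically closed field and V a K-vector space of dimension n. Fix a dimension type 0 < k_1 < ... < k_m < n and integers 0 < a, b < n. Then the GL(V)-action on triples (U_1 ⊆ ... ⊆ U_m, A, B), where U_1 ⊆ ... ⊆ U_m is a partial flag of type (k_1, ..., k_m) and A, B are subspaces of V with dim A = a and dim B = b, has finitely many orbits. -/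
open Module

namespace FlagTwo
open Submodule Set

variable {K V : Type*} [Field K] [AddCommGroup V] [Module K V]

/-- The span of chosen vectors and chosen pair sums. -/
def psp (K : Type*) {V : Type*} [Field K] [AddCommGroup V] [Module K V]
    (e : ℕ → V) (J : Set ℕ) (P : Set (ℕ × ℕ)) : Submodule K V :=
  span K (e '' J ∪ (fun p : ℕ × ℕ => e p.1 + e p.2) '' P)

/-- Normal form up to stage `N`. -/
structure Good (F : ℕ → Submodule K V) (A B : Submodule K V) (N : ℕ) (e : ℕ → V)
    (I J : Set ℕ) (P : Set (ℕ × ℕ)) : Prop where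
  flag : ∀ i ≤ N, span K (e '' Iio i) = F i
  hI : I ⊆ Iio N
  hJ : J ⊆ Iio N
  hP1 : ∀ p ∈ P, p.1 ∈ I
  hP2 : ∀ p ∈ P, p.2 < N
  eA : A ⊓ F N = span K (e '' I)
  eB : B ⊓ F N = psp K e J P

theorem image_upd (e : ℕ → V) (S : Set ℕ) (i : ℕ) (x : V) (h : i ∉ S) :
    Function.update e i x '' S = e '' S := by
  apply image_congr
  intro a ha
  rw [Function.update_of_ne]
  rintro rfl; exact h ha

theorem psp_upd (e : ℕ → V) (J : Set ℕ) (P : Set (ℕ × ℕ)) (i : ℕ) (x : V) (h : i ∉ J)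
    (h1 : ∀ p ∈ P, p.1 ≠ i) (h2 : ∀ p ∈ P, p.2 ≠ i) :
    psp K (Function.update e i x) J P = psp K e J P := by
  unfold psp
  rw [image_upd e J i x h]
  congr 2
  apply image_congr
  intro a ha
  simp [Function.update_of_ne (h1 a ha), Function.update_of_ne (h2 a ha)]

theorem Good.upd {F : ℕ → Submodule K V} {A B : Submodule K V} {N : ℕ} {e : ℕ → V}
    {I J : Set ℕ} {P : Set (ℕ × ℕ)} (h : Good F A B N e I J P) {q : ℕ}
    (hqI : q ∉ I) (hqJ : q ∉ J) (hqP : ∀ p ∈ P, p.2 ≠ q) {c : K} (hc : c ≠ 0) {r : V}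
    (hr : r ∈ span K (e '' Iio q)) :
    Good F A B N (Function.update e q (c • e q + r)) I J P := by
  refine ⟨?_, h.hI, h.hJ, h.hP1, h.hP2, ?_, ?_⟩
  · intro i hi
    rw [← h.flag i hi]
    by_cases hqi : q < i
    · have hm : span K (e '' Iio q) ≤ span K (e '' Iio i) :=
        span_mono (image_mono (Iio_subset_Iio hqi.le))
      have hq0 : span K (Function.update e q (c • e q + r) '' Iio q) = span K (e '' Iio q) := by
        rw [image_upd _ _ _ _ (by simp)]
      have hm' : span K (e '' Iio q) ≤
          span K (Function.update e q (c • e q + r) '' Iio i) := by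
        rw [← hq0]
        exact span_mono (image_mono (Iio_subset_Iio hqi.le))
      apply le_antisymm
      · rw [span_le]
        rintro _ ⟨j, hj, rfl⟩
        by_cases hjq : j = q
        · subst hjq
          simp only [Function.update_self, SetLike.mem_coe]
          exact add_mem (smul_mem _ _ (subset_span ⟨j, hj, rfl⟩)) (hm hr)
        · rw [Function.update_of_ne hjq]
          exact subset_span ⟨j, hj, rfl⟩
      · rw [span_le]
        rintro _ ⟨j, hj, rfl⟩
        by_cases hjq : j = q
        · subst hjq
          have h1 : c • e j + r ∈ span K (Function.update e j (c • e j + r) '' Iio i) :=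
            subset_span ⟨j, hj, by simp⟩
          have h2 := smul_mem _ c⁻¹ (sub_mem h1 (hm' hr))
          simpa [smul_smul, hc] using h2
        · exact subset_span ⟨j, hj, by rw [Function.update_of_ne hjq]⟩
    · rw [image_upd _ _ _ _ (by simpa using hqi)]
  · rw [image_upd _ _ _ _ hqI, h.eA]
  · rw [psp_upd _ _ _ _ _ hqJ (fun p hp hpq => hqI (hpq ▸ h.hP1 p hp)) hqP, h.eB]

theorem flag_step {F : ℕ → Submodule K V} {N : ℕ} {e : ℕ → V}
    (h : ∀ i ≤ N, span K (e '' Iio i) = F i) {x : V} (hx : F (N + 1) = F N ⊔ span K {x}) :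
    ∀ i ≤ N + 1, span K (Function.update e N x '' Iio i) = F i := by
  intro i hi
  rcases Nat.lt_or_ge N i with hlt | hle
  · obtain rfl : i = N + 1 := by omega
    have : Iio (N + 1) = insert N (Iio N) := by ext x; simp only [mem_insert_iff, mem_Iio]; omega
    rw [this, image_insert_eq, image_upd _ _ _ _ (by simp), Function.update_self, hx,
      span_insert, h N le_rfl, sup_comm]
  · rw [image_upd _ _ _ _ (by simpa using hle), h i hle]

theorem hyper {F : ℕ → Submodule K V} {N : ℕ} {w : V} (hF : F (N + 1) = F N ⊔ span K {w})
    (A : Submodule K V) :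
    A ⊓ F (N + 1) = A ⊓ F N ∨ ∃ a ∈ A, a - w ∈ F N := by
  by_cases h : A ⊓ F (N + 1) ≤ F N
  · left
    apply le_antisymm (le_inf inf_le_left h)
    exact inf_le_inf_left _ (hF ▸ le_sup_left)
  · right
    obtain ⟨a, ha, haF⟩ := SetLike.not_le_iff_exists.1 h
    obtain ⟨haA, ha2⟩ := ha
    rw [hF] at ha2
    obtain ⟨y, hy, z, hz, hyz⟩ := mem_sup.1 ha2
    obtain ⟨t, rfl⟩ := mem_span_singleton.1 hz
    have ht : t ≠ 0 := by
      rintro rfl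
      apply haF
      rw [← hyz]; simpa using hy
    refine ⟨t⁻¹ • a, smul_mem _ _ haA, ?_⟩
    rw [← hyz]
    simpa [smul_add, smul_smul, ht] using smul_mem _ t⁻¹ hy

theorem flag_rep {F : ℕ → Submodule K V} {N : ℕ} {w a : V}
    (hF : F (N + 1) = F N ⊔ span K {w}) (ha : a - w ∈ F N) :
    F (N + 1) = F N ⊔ span K {a} := by
  rw [hF]
  apply le_antisymm
  · refine sup_le le_sup_left ?_
    rw [span_singleton_le_iff_mem]
    have := sub_mem (mem_sup_right (mem_span_singleton_self a) : a ∈ F N ⊔ span K {a})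
      (mem_sup_left ha)
    simpa using this
  · refine sup_le le_sup_left ?_
    rw [span_singleton_le_iff_mem]
    have := add_mem (mem_sup_right (mem_span_singleton_self w) : w ∈ F N ⊔ span K {w})
      (mem_sup_left ha)
    simpa using this

theorem inf_rep {F : ℕ → Submodule K V} {N : ℕ} {a : V}
    (hF : F (N + 1) = F N ⊔ span K {a}) {A : Submodule K V} (ha : a ∈ A) :
    A ⊓ F (N + 1) = span K {a} ⊔ A ⊓ F N := by
  have : span K {a} ≤ A := by simpa using ha
  rw [hF, inf_comm A (F N), sup_comm (F N), ← sup_inf_assoc_of_le _ this, inf_comm]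

theorem lead (e : ℕ → V) (R : Set ℕ) (N : ℕ) (x : V) (hx : x ∈ span K (e '' (R ∩ Iio N))) :
    x = 0 ∨ ∃ q ∈ R, q < N ∧ ∃ c : K, c ≠ 0 ∧ ∃ r ∈ span K (e '' Iio q), x = c • e q + r := by
  induction N with
  | zero => left; simpa using hx
  | succ N ih =>
    by_cases hN : N ∈ R
    · have : R ∩ Iio (N + 1) = insert N (R ∩ Iio N) := by
        ext j; simp only [mem_inter_iff, mem_Iio, mem_insert_iff]
        constructor
        · rintro ⟨h1, h2⟩
          by_cases h : j = N
          · exact Or.inl h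
          · exact Or.inr ⟨h1, by omega⟩
        · rintro (rfl | ⟨h1, h2⟩)
          · exact ⟨hN, by omega⟩
          · exact ⟨h1, by omega⟩
      rw [this, image_insert_eq, mem_span_insert] at hx
      obtain ⟨c, z, hz, rfl⟩ := hx
      by_cases hc : c = 0
      · subst hc
        rcases ih (by simpa using hz) with h | ⟨q, h1, h2, h3⟩
        · exact Or.inl h
        · exact Or.inr ⟨q, h1, by omega, h3⟩
      · exact Or.inr ⟨N, hN, by omega, c, hc, z, span_mono (image_mono inter_subset_right) hz, rfl⟩
    · have : R ∩ Iio (N + 1) = R ∩ Iio N := by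
        ext j; simp only [mem_inter_iff, mem_Iio]
        refine and_congr_right fun hj => ?_
        have : j ≠ N := by rintro rfl; exact hN hj
        omega
      rw [this] at hx
      rcases ih hx with h | ⟨q, h1, h2, h3⟩
      · exact Or.inl h
      · exact Or.inr ⟨q, h1, by omega, h3⟩

theorem psp_insJ (e : ℕ → V) (J : Set ℕ) (P : Set (ℕ × ℕ)) (j : ℕ) :
    psp K e (insert j J) P = span K {e j} ⊔ psp K e J P := by
  unfold psp
  rw [image_insert_eq, insert_union, span_insert]

theorem psp_insP (e : ℕ → V) (J : Set ℕ) (P : Set (ℕ × ℕ)) (p : ℕ × ℕ) :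
    psp K e J (insert p P) = span K {e p.1 + e p.2} ⊔ psp K e J P := by
  unfold psp
  rw [image_insert_eq, union_insert, span_insert]

theorem Good.step {F : ℕ → Submodule K V} {A B : Submodule K V} {N : ℕ} {e : ℕ → V}
    {I J : Set ℕ} {P : Set (ℕ × ℕ)} (h : Good F A B N e I J P) {w : V}
    (hF : F (N + 1) = F N ⊔ span K {w}) :
    ∃ e' I' J' P', Good F A B (N + 1) e' I' J' P' := by
  have hsub : Iio N ⊆ Iio (N + 1) := Iio_subset_Iio (by omega)
  have nI : N ∉ I := fun hh => lt_irrefl N (mem_Iio.1 (h.hI hh))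
  have nJ : N ∉ J := fun hh => lt_irrefl N (mem_Iio.1 (h.hJ hh))
  have nP1 : ∀ p ∈ P, p.1 ≠ N := fun p hp => ne_of_lt (h.hI (h.hP1 p hp))
  have nP2 : ∀ p ∈ P, p.2 ≠ N := fun p hp => ne_of_lt (h.hP2 p hp)
  have hP2 : ∀ p ∈ P, p.2 < N + 1 := fun p hp => (h.hP2 p hp).trans (by omega)
  have iI : insert N I ⊆ Iio (N + 1) := insert_subset (by simp) (h.hI.trans hsub)
  have iJ : insert N J ⊆ Iio (N + 1) := insert_subset (by simp) (h.hJ.trans hsub)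
  have iP1 : ∀ p ∈ P, p.1 ∈ insert N I := fun p hp => Or.inr (h.hP1 p hp)
  rcases hyper hF A with hA | ⟨a, haA, haw⟩
  · rcases hyper hF B with hB | ⟨b, hbB, hbw⟩
    · refine ⟨Function.update e N w, I, J, P, flag_step h.flag hF, h.hI.trans hsub,
        h.hJ.trans hsub, h.hP1, hP2, ?_, ?_⟩
      · rw [hA, h.eA, image_upd _ _ _ _ nI]
      · rw [hB, h.eB, psp_upd _ _ _ _ _ nJ nP1 nP2]
    · have hF' := flag_rep hF hbw
      refine ⟨Function.update e N b, I, insert N J, P, flag_step h.flag hF', h.hI.trans hsub,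
        iJ, h.hP1, hP2, ?_, ?_⟩
      · rw [hA, h.eA, image_upd _ _ _ _ nI]
      · rw [inf_rep hF' hbB, h.eB, psp_insJ, psp_upd _ _ _ _ _ nJ nP1 nP2, Function.update_self]
  · rcases hyper hF B with hB | ⟨b, hbB, hbw⟩
    · have hF' := flag_rep hF haw
      refine ⟨Function.update e N a, insert N I, J, P, flag_step h.flag hF', iI,
        h.hJ.trans hsub, iP1, hP2, ?_, ?_⟩
      · rw [inf_rep hF' haA, h.eA, image_insert_eq, span_insert, image_upd _ _ _ _ nI,
          Function.update_self]
      · rw [hB, h.eB, psp_upd _ _ _ _ _ nJ nP1 nP2]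
    · set R : Set ℕ := {q | q ∉ I ∧ q ∉ J ∧ ∀ p ∈ P, p.2 ≠ q} with hR
      have hba : b - a ∈ F N := by
        have := sub_mem hbw haw
        simpa using this
      have hdec : F N ≤ (A ⊓ F N) ⊔ ((B ⊓ F N) ⊔ span K (e '' (R ∩ Iio N))) := by
        conv_lhs => rw [← h.flag N le_rfl]
        rw [span_le]
        rintro _ ⟨q, hq, rfl⟩
        have hAI : ∀ q ∈ I, e q ∈ A ⊓ F N := fun q hq => by
          rw [h.eA]; exact subset_span ⟨q, hq, rfl⟩
        by_cases hqI : q ∈ I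
        · exact mem_sup_left (hAI q hqI)
        by_cases hqJ : q ∈ J
        · refine mem_sup_right (mem_sup_left ?_)
          rw [h.eB]; exact subset_span (Or.inl ⟨q, hqJ, rfl⟩)
        by_cases hqP : ∀ p ∈ P, p.2 ≠ q
        · exact mem_sup_right (mem_sup_right (subset_span ⟨q, ⟨⟨hqI, hqJ, hqP⟩, hq⟩, rfl⟩))
        · push Not at hqP
          obtain ⟨p, hp, rfl⟩ := hqP
          have h1 : e p.1 + e p.2 ∈ B ⊓ F N := by
            rw [h.eB]; exact subset_span (Or.inr ⟨p, hp, rfl⟩)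
          have h2 := hAI _ (h.hP1 p hp)
          have h3 := sub_mem (mem_sup_right (mem_sup_left h1) : e p.1 + e p.2 ∈
            (A ⊓ F N) ⊔ ((B ⊓ F N) ⊔ span K (e '' (R ∩ Iio N)))) (mem_sup_left h2)
          simpa using h3
      obtain ⟨α, hα, y, hy, hαy⟩ := mem_sup.1 (hdec hba)
      obtain ⟨β, hβ, r, hr, rfl⟩ := mem_sup.1 hy
      have ha' : a + α ∈ A := add_mem haA hα.1
      have haw' : (a + α) - w ∈ F N := by
        have := add_mem haw hα.2
        convert this using 1; abel
      have hb' : b - β ∈ B := sub_mem hbB hβ.1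
      have hbw' : (b - β) - w ∈ F N := by
        have := sub_mem hbw hβ.2
        convert this using 1; abel
      have hrel : b - β = (a + α) + r := by
        have : b = a + (α + (β + r)) := by rw [hαy]; abel
        rw [this]; abel
      have hFa := flag_rep hF haw'
      have hFb := flag_rep hF hbw'
      rcases lead e R N r hr with rfl | ⟨q, hqR, hqN, c, hc, r', hr', hrq⟩
      · refine ⟨Function.update e N (a + α), insert N I, insert N J, P, flag_step h.flag hFa, iI,
          iJ, iP1, hP2, ?_, ?_⟩
        · rw [inf_rep hFa ha', h.eA, image_insert_eq, span_insert, image_upd _ _ _ _ nI,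
            Function.update_self]
        · rw [inf_rep hFb hb', h.eB, psp_insJ, psp_upd _ _ _ _ _ nJ nP1 nP2,
            Function.update_self, hrel, add_zero]
      · have h' := h.upd hqR.1 hqR.2.1 hqR.2.2 hc hr'
        set e1 := Function.update e q (c • e q + r') with he1
        refine ⟨Function.update e1 N (a + α), insert N I, J, insert (N, q) P,
          flag_step h'.flag hFa, iI, h.hJ.trans hsub, ?_, ?_, ?_, ?_⟩
        · rintro p (rfl | hp)
          · exact Or.inl rfl
          · exact iP1 p hp
        · rintro p (rfl | hp)
          · exact hqN.trans (by simp)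
          · exact hP2 p hp
        · rw [inf_rep hFa ha', h'.eA, image_insert_eq, span_insert, image_upd _ _ _ _ nI,
            Function.update_self]
        · rw [inf_rep hFb hb', h'.eB, psp_insP, psp_upd _ _ _ _ _ nJ nP1 nP2]
          simp only [Function.update_self, Function.update_of_ne hqN.ne]
          rw [he1, Function.update_self, ← hrq, hrel]

theorem exists_good (F : ℕ → Submodule K V) (w : ℕ → V) (h0 : F 0 = ⊥)
    (hF : ∀ i, F (i + 1) = F i ⊔ span K {w i}) (A B : Submodule K V) (N : ℕ) :
    ∃ e I J P, Good F A B N e I J P := by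
  induction N with
  | zero =>
    refine ⟨fun _ => 0, ∅, ∅, ∅, ?_, by simp, by simp, by simp, by simp, ?_, ?_⟩
    · intro i hi
      obtain rfl : i = 0 := by omega
      simp [h0]
    · simp [h0]
    · simp [h0, psp]
  | succ N ih =>
    obtain ⟨e, I, J, P, h⟩ := ih
    exact h.step (hF N)

theorem exists_adapted [FiniteDimensional K V] {n m : ℕ} (hn : finrank K V = n)
    (k : Fin m → ℕ) (hk : StrictMono k) (U : Fin m → Submodule K V) (hU : Monotone U)
    (hd : ∀ i, finrank K (U i) = k i) (d : ℕ) (hdn : d ≤ n) :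
    ∃ w : Fin d → V, LinearIndependent K w ∧ ∀ i (j : Fin d), (j : ℕ) < k i → w j ∈ U i := by
  induction d with
  | zero => exact ⟨Fin.elim0, linearIndependent_empty_type, fun i j => j.elim0⟩
  | succ d ih =>
    obtain ⟨w, hw, hwU⟩ := ih (by omega)
    have hT : ∃ T : Submodule K V, d < finrank K T ∧ ∀ i, d < k i → T ≤ U i := by
      by_cases hne : ∃ i, d < k i
      · have hfin : (Finset.univ.filter (fun i => d < k i)).Nonempty := by
          obtain ⟨i, hi⟩ := hne; exact ⟨i, by simpa using hi⟩
        obtain ⟨i0, hi0, hmin⟩ := Finset.exists_min_image _ id hfin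
        simp only [Finset.mem_filter, Finset.mem_univ, true_and, id] at hi0 hmin
        exact ⟨U i0, by rw [hd]; exact hi0, fun i hi => hU (hmin i hi)⟩
      · exact ⟨⊤, by rw [finrank_top, hn]; omega, fun i hi => absurd ⟨i, hi⟩ hne⟩
    obtain ⟨T, hTd, hTU⟩ := hT
    have : ¬ T ≤ span K (range w) := by
      intro hle
      have h1 := Submodule.finrank_mono hle
      have h2 := finrank_range_le_card (R := K) w
      simp only [Fintype.card_fin, Set.finrank] at h2
      omega
    obtain ⟨x, hxT, hx⟩ := SetLike.not_le_iff_exists.1 this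
    refine ⟨Fin.snoc w x, (linearIndependent_finSnoc).2 ⟨hw, hx⟩, ?_⟩
    intro i j
    refine Fin.lastCases ?_ (fun j => ?_) j
    · intro hj
      simp only [Fin.snoc_last]
      exact hTU i (by simpa using hj) hxT
    · intro hj
      simp only [Fin.snoc_castSucc]
      exact hwU i j (by simpa using hj)

/-- The normal form theorem. -/
theorem normal_form [FiniteDimensional K V] {n m : ℕ} (hn : finrank K V = n)
    (k : Fin m → ℕ) (hk : StrictMono k) (hkn : ∀ i, k i < n)
    (U : Fin m → Submodule K V) (hU : Monotone U)
    (hd : ∀ i, finrank K (U i) = k i) (A B : Submodule K V) :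
    ∃ (e : ℕ → V) (I J : Set ℕ) (P : Set (ℕ × ℕ)),
      span K (e '' Iio n) = ⊤ ∧ (∀ i, U i = span K (e '' Iio (k i))) ∧
      I ⊆ Iio n ∧ J ⊆ Iio n ∧ P ⊆ Iio n ×ˢ Iio n ∧
      A = span K (e '' I) ∧ B = psp K e J P := by
  obtain ⟨w, hw, hwU⟩ := exists_adapted hn k hk U hU hd n le_rfl
  let w' : ℕ → V := fun i => if h : i < n then w ⟨i, h⟩ else 0
  let F : ℕ → Submodule K V := fun i => span K (w' '' Iio i)
  have hdim : ∀ d ≤ n, finrank K (F d) = d := by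
    intro d hdn
    have h1 : LinearIndependent K (fun i : Fin d => w (Fin.castLE hdn i)) :=
      hw.comp _ (Fin.castLE_injective hdn)
    have h2 := finrank_span_eq_card h1
    have h3 : range (fun i : Fin d => w (Fin.castLE hdn i)) = w' '' Iio d := by
      ext x
      constructor
      · rintro ⟨i, rfl⟩
        refine ⟨i, i.2, ?_⟩
        have : (i : ℕ) < n := by omega
        simp only [w', this, dif_pos]; rfl
      · rintro ⟨i, hi, rfl⟩
        have : i < n := lt_of_lt_of_le hi hdn
        refine ⟨⟨i, hi⟩, ?_⟩
        simp only [w', this, dif_pos]; rfl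
    rw [h3] at h2
    simpa using h2
  have hFn : F n = ⊤ := by
    apply Submodule.eq_top_of_finrank_eq
    rw [hdim n le_rfl, hn]
  have hFU : ∀ i, F (k i) = U i := by
    intro i
    apply Submodule.eq_of_le_of_finrank_eq
    · rw [span_le]
      rintro _ ⟨j, hj, rfl⟩
      have : j < n := lt_trans hj (hkn i)
      simp only [w', this, dif_pos]
      exact hwU i ⟨j, this⟩ hj
    · rw [hdim _ (hkn i).le, hd]
  obtain ⟨e, I, J, P, h⟩ := exists_good F w' (by simp [F]) (by
    intro i
    have : Iio (i + 1) = insert i (Iio i) := by ext x; simp only [mem_insert_iff, mem_Iio]; omega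
    simp only [F]
    rw [this, image_insert_eq, span_insert, sup_comm]) A B n
  refine ⟨e, I, J, P, by rw [h.flag n le_rfl, hFn], ?_, h.hI, h.hJ, ?_, ?_, ?_⟩
  · intro i
    rw [h.flag _ (hkn i).le, hFU]
  · intro p hp
    exact ⟨h.hI (h.hP1 p hp), h.hP2 p hp⟩
  · rw [← h.eA, hFn, inf_top_eq]
  · rw [← h.eB, hFn, inf_top_eq]

theorem exists_basis [FiniteDimensional K V] {n : ℕ} (hn : finrank K V = n) (e : ℕ → V)
    (he : span K (e '' Iio n) = ⊤) : ∃ b : Basis (Fin n) K V, ∀ i : Fin n, b i = e i := by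
  have hr : range (fun i : Fin n => e i) = e '' Iio n := by
    ext x
    constructor
    · rintro ⟨i, rfl⟩; exact ⟨i, i.2, rfl⟩
    · rintro ⟨i, hi, rfl⟩; exact ⟨⟨i, hi⟩, rfl⟩
  have hs : ⊤ ≤ span K (range (fun i : Fin n => e i)) := by rw [hr, he]
  exact ⟨basisOfTopLeSpanOfCardEqFinrank _ hs (by simp [hn]), by simp⟩

theorem map_span_eq {e f : ℕ → V} {n : ℕ} (g : V ≃ₗ[K] V) (hg : ∀ i < n, g (e i) = f i)
    {I : Set ℕ} (hI : I ⊆ Iio n) :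
    (span K (e '' I)).map g.toLinearMap = span K (f '' I) := by
  rw [Submodule.map_span, image_image]
  congr 1
  exact image_congr fun i hi => hg i (hI hi)

theorem map_psp_eq {e f : ℕ → V} {n : ℕ} (g : V ≃ₗ[K] V) (hg : ∀ i < n, g (e i) = f i)
    {J : Set ℕ} (hJ : J ⊆ Iio n) {P : Set (ℕ × ℕ)} (hP : P ⊆ Iio n ×ˢ Iio n) :
    (psp K e J P).map g.toLinearMap = psp K f J P := by
  unfold psp
  rw [Submodule.map_span, image_union, image_image, image_image]
  congr 2
  · exact image_congr fun i hi => hg i (hJ hi)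
  · refine image_congr fun p hp => ?_
    have := hP hp
    simp only [LinearEquiv.coe_coe, map_add]
    rw [hg _ this.1, hg _ this.2]

end FlagTwo


/-- GL(V) has finitely many orbits on triples consisting of a partial flag and two
further subspaces of fixed dimensions. -/
theorem finitely_many_orbits_flag_and_two_subspaces
    (K : Type*) [Field K] [IsAlgClosed K] (V : Type*) [AddCommGroup V] [Module K V]
    [FiniteDimensional K V] (n m a b : ℕ) (hn : finrank K V = n)
    (k : Fin m → ℕ) (hk : StrictMono k) (hk0 : ∀ i, 0 < k i) (hkn : ∀ i, k i < n)
    (ha0 : 0 < a) (han : a < n) (hb0 : 0 < b) (hbn : b < n) :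
    { O : Set ((Fin m → Submodule K V) × Submodule K V × Submodule K V) |
        ∃ c : (Fin m → Submodule K V) × Submodule K V × Submodule K V,
          (Monotone c.1 ∧ (∀ i, finrank K (c.1 i) = k i) ∧
            finrank K c.2.1 = a ∧ finrank K c.2.2 = b) ∧
          O = { c' | ∃ g : V ≃ₗ[K] V,
            (∀ i, (c.1 i).map g.toLinearMap = c'.1 i) ∧
            c.2.1.map g.toLinearMap = c'.2.1 ∧
            c.2.2.map g.toLinearMap = c'.2.2 } }.Finite := by

  classical
  let b0 : Basis (Fin n) K V := finBasisOfFinrankEq K V hn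
  let f : ℕ → V := fun i => if h : i < n then b0 ⟨i, h⟩ else 0
  let Φ : Set ℕ × Set ℕ × Set (ℕ × ℕ) →
      Set ((Fin m → Submodule K V) × Submodule K V × Submodule K V) := fun d =>
    { c' | ∃ g : V ≃ₗ[K] V,
            (∀ i, (Submodule.span K (f '' Set.Iio (k i))).map g.toLinearMap = c'.1 i) ∧
            (Submodule.span K (f '' d.1)).map g.toLinearMap = c'.2.1 ∧
            (FlagTwo.psp K f d.2.1 d.2.2).map g.toLinearMap = c'.2.2 }
  have hD : (Set.powerset (Set.Iio n) ×ˢ (Set.powerset (Set.Iio n) ×ˢ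
      Set.powerset (Set.Iio n ×ˢ Set.Iio n)) : Set (Set ℕ × Set ℕ × Set (ℕ × ℕ))).Finite :=
    (Set.finite_Iio n).powerset.prod ((Set.finite_Iio n).powerset.prod
      ((Set.finite_Iio n).prod (Set.finite_Iio n)).powerset)
  refine (hD.image Φ).subset ?_
  rintro O ⟨⟨U, A, B⟩, ⟨hU, hd, -, -⟩, rfl⟩
  obtain ⟨e, I, J, P, he, hUe, hI, hJ, hP, hA, hB⟩ :=
    FlagTwo.normal_form hn k hk hkn U hU hd A B
  refine ⟨(I, J, P), ⟨hI, hJ, hP⟩, ?_⟩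
  obtain ⟨b, hb⟩ := FlagTwo.exists_basis hn e he
  let g0 : V ≃ₗ[K] V := b.equiv b0 (Equiv.refl _)
  have hg0 : ∀ i < n, g0 (e i) = f i := by
    intro i hi
    have := hb ⟨i, hi⟩
    simp only at this
    rw [← this]
    simp [g0, f, hi]
  have hg1 : ∀ i < n, g0.symm (f i) = e i := by
    intro i hi
    rw [← hg0 i hi]; simp
  have hkI : ∀ i, Set.Iio (k i) ⊆ Set.Iio n := fun i => Set.Iio_subset_Iio (hkn i).le
  ext ⟨U', A', B'⟩
  simp only [Φ, Set.mem_setOf_eq]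
  constructor
  · rintro ⟨g, h1, h2, h3⟩
    refine ⟨g0.trans g, ?_, ?_, ?_⟩
    · intro i
      rw [LinearEquiv.coe_trans, Submodule.map_comp, hUe i,
        FlagTwo.map_span_eq g0 hg0 (hkI i), h1]
    · rw [LinearEquiv.coe_trans, Submodule.map_comp, hA, FlagTwo.map_span_eq g0 hg0 hI, h2]
    · rw [LinearEquiv.coe_trans, Submodule.map_comp, hB, FlagTwo.map_psp_eq g0 hg0 hJ hP, h3]
  · rintro ⟨g, h1, h2, h3⟩
    refine ⟨g0.symm.trans g, ?_, ?_, ?_⟩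
    · intro i
      rw [LinearEquiv.coe_trans, Submodule.map_comp,
        FlagTwo.map_span_eq g0.symm hg1 (hkI i), ← hUe i, h1]
    · rw [LinearEquiv.coe_trans, Submodule.map_comp, FlagTwo.map_span_eq g0.symm hg1 hI, ← hA, h2]
    · rw [LinearEquiv.coe_trans, Submodule.map_comp, FlagTwo.map_psp_eq g0.symm hg1 hJ hP,
        ← hB, h3]
end

section
/- Let K be an algebraically closed field and V a K-vector space of dimension n. Fix dimension types 0 < a_1 < ... < a_p < n and 0 < b_1 < ... < b_q < n, and let c ∈ {1, n − 1}. Then the GL(V)-action on triples (A_1 ⊆ ... ⊆ A_p, B_1 ⊆ ... ⊆ B_q, L), where the first two entries are partial flags of types (a_1, ..., a_p) and (b_1, ..., b_q) and L is a subspace of V with dim L = c, has finitely many orbits. -/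
open Module

lemma adapted_aux {K V : Type*} [Field K] [AddCommGroup V] [Module K V] [FiniteDimensional K V]
    (A B : Set (Submodule K V)) (hA : IsChain (· ≤ ·) A) (hB : IsChain (· ≤ ·) B)
    (W : Submodule K V) :
    ∃ s : Set V, LinearIndepOn K id s ∧ Submodule.span K s = W ∧
      (∀ X ∈ A, X ⊓ W ≤ Submodule.span K (s ∩ X)) ∧
      (∀ X ∈ B, X ⊓ W ≤ Submodule.span K (s ∩ X)) := by
  induction W using WellFoundedLT.induction with
  | ind W ih =>
  by_cases hW : W = ⊥
  · subst hW
    exact ⟨∅, linearIndepOn_empty K id, by simp, by simp, by simp⟩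
  -- the hyperplane
  have hM : ∃ H : Submodule K V, H < W ∧ ∀ X ∈ A, X ⊓ W < W → X ⊓ W ≤ H := by
    by_cases hne : ({M | ∃ X ∈ A, M = X ⊓ W ∧ X ⊓ W < W} : Set (Submodule K V)).Nonempty
    · obtain ⟨M, ⟨X, hX, rfl, hXW⟩, hmax⟩ :=
        (wellFounded_gt (α := Submodule K V)).has_min _ hne
      refine ⟨X ⊓ W, hXW, fun Y hY hYW => ?_⟩
      rcases hA.total hY hX with h | h
      · exact inf_le_inf_right W h
      · have h1 : X ⊓ W ≤ Y ⊓ W := inf_le_inf_right W h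
        by_contra h2
        exact hmax (Y ⊓ W) ⟨Y, hY, rfl, hYW⟩ (lt_of_le_not_ge h1 h2)
    · refine ⟨⊥, bot_lt_iff_ne_bot.2 hW, fun X hX hXW => ?_⟩
      exact (hne ⟨X ⊓ W, X, hX, rfl, hXW⟩).elim
  obtain ⟨H, ⟨hHW, hHA⟩, hmax⟩ := (wellFounded_gt (α := Submodule K V)).has_min
    {H | H < W ∧ ∀ X ∈ A, X ⊓ W < W → X ⊓ W ≤ H} hM
  have hv : ∃ v ∈ W, v ∉ H ∧ ∀ X ∈ B, ¬ X ⊓ W ≤ H → v ∈ X := by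
    by_cases hne : ({X | X ∈ B ∧ ¬ X ⊓ W ≤ H} : Set (Submodule K V)).Nonempty
    · obtain ⟨X, ⟨hX, hXH⟩, hmin⟩ := (wellFounded_lt (α := Submodule K V)).has_min _ hne
      obtain ⟨v, hvX, hvH⟩ := SetLike.not_le_iff_exists.1 hXH
      refine ⟨v, hvX.2, hvH, fun Y hY hYH => ?_⟩
      rcases hB.total hX hY with h | h
      · exact h hvX.1
      · have : X ≤ Y := by
          by_contra h2
          exact hmin Y ⟨hY, hYH⟩ (lt_of_le_not_ge h h2)
        exact this hvX.1
    · obtain ⟨v, hvW, hvH⟩ := SetLike.exists_of_lt hHW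
      exact ⟨v, hvW, hvH, fun X hX h => (hne ⟨X, hX, h⟩).elim⟩
  obtain ⟨v, hvW, hvH, hvB⟩ := hv
  have hsup : H ⊔ Submodule.span K {v} = W := by
    have hle : H ⊔ Submodule.span K {v} ≤ W :=
      sup_le hHW.le (by simpa using hvW)
    by_contra hne
    refine hmax (H ⊔ Submodule.span K {v}) ⟨lt_of_le_of_ne hle hne, fun X hX h =>
      (hHA X hX h).trans le_sup_left⟩ ?_
    refine lt_of_le_not_ge le_sup_left fun h => hvH (h ?_)
    exact (le_sup_right : _ ≤ H ⊔ Submodule.span K {v}) (Submodule.mem_span_singleton_self v)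
  obtain ⟨s, hs, hsH, hsA, hsB⟩ := ih H hHW
  have hspan : Submodule.span K (insert v s) = W := by
    rw [Submodule.span_insert, hsH, sup_comm, hsup]
  have hmono : ∀ X : Submodule K V, Submodule.span K (s ∩ X) ≤
      Submodule.span K (insert v s ∩ X) := fun X =>
    Submodule.span_mono (Set.inter_subset_inter_left _ (Set.subset_insert v s))
  refine ⟨insert v s, hs.id_insert (by rwa [hsH]), hspan, fun X hX => ?_, fun X hX => ?_⟩
  · by_cases h : X ⊓ W < W
    · exact (le_inf inf_le_left (hHA X hX h)).trans ((hsA X hX).trans (hmono X))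
    · have hWX : W ≤ X := by
        by_contra h2
        exact h (lt_of_le_not_ge inf_le_right fun h3 => h2 (h3.trans inf_le_left))
      have : insert v s ∩ (X : Set V) = insert v s := by
        refine Set.inter_eq_left.2 fun x hx => hWX ?_
        rw [← hspan]
        exact Submodule.subset_span hx
      rw [this, hspan]
      exact inf_le_right
  · by_cases h : X ⊓ W ≤ H
    · exact (le_inf inf_le_left h).trans ((hsB X hX).trans (hmono X))
    · have hvX := hvB X hX h
      rintro x ⟨hxX, hxW⟩
      have hxW' : x ∈ H ⊔ Submodule.span K {v} := by rw [hsup]; exact hxW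
      obtain ⟨y, hy, z, hz, rfl⟩ := Submodule.mem_sup.1 hxW'
      obtain ⟨r, rfl⟩ := Submodule.mem_span_singleton.1 hz
      have hyX : y ∈ X := by
        have := X.sub_mem hxX (X.smul_mem r hvX)
        simpa using this
      refine Submodule.add_mem _ (hmono X (hsB X hX ⟨hyX, hy⟩)) (Submodule.smul_mem _ _ ?_)
      exact Submodule.subset_span ⟨Set.mem_insert v s, hvX⟩

lemma adapted_basis {K V : Type*} [Field K] [AddCommGroup V] [Module K V] [FiniteDimensional K V]
    (n : ℕ) (hn : finrank K V = n)
    (A B : Set (Submodule K V)) (hA : IsChain (· ≤ ·) A) (hB : IsChain (· ≤ ·) B) :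
    ∃ e : Basis (Fin n) K V,
      (∀ X ∈ A, ∃ S : Set (Fin n), X = Submodule.span K (e '' S)) ∧
      (∀ X ∈ B, ∃ S : Set (Fin n), X = Submodule.span K (e '' S)) := by
  obtain ⟨s, hs, hsp, hsA, hsB⟩ := adapted_aux A B hA hB ⊤
  let e0 : Basis s K V := Basis.mk (v := fun x : s => (x : V)) hs (by
    rw [Subtype.range_coe_subtype]; simpa using hsp.ge)
  haveI : Fintype s := FiniteDimensional.fintypeBasisIndex e0
  have hc : Fintype.card s = n := by rw [← hn, finrank_eq_card_basis e0]
  let e : Basis (Fin n) K V := e0.reindex (Fintype.equivFinOfCardEq hc)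
  have key : ∀ X : Submodule K V, X ⊓ ⊤ ≤ Submodule.span K (s ∩ X) →
      ∃ S : Set (Fin n), X = Submodule.span K (e '' S) := by
    intro X hX
    refine ⟨{k | e k ∈ X}, le_antisymm ?_ ?_⟩
    · rw [inf_top_eq] at hX
      refine hX.trans (Submodule.span_mono ?_)
      rintro x ⟨hx, hxX⟩
      have : e (Fintype.equivFinOfCardEq hc ⟨x, hx⟩) = x := by
        simp only [e, Basis.reindex_apply, Equiv.symm_apply_apply]
        exact Basis.mk_apply (v := fun x : s => (x : V)) hs _ ⟨x, hx⟩
      exact ⟨_, by simpa [this] using hxX, this⟩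
    · rw [Submodule.span_le]
      rintro _ ⟨k, hk, rfl⟩
      exact hk
  exact ⟨e, fun X hX => key X (hsA X hX), fun X hX => key X (hsB X hX)⟩

lemma span_scaled {K V ι : Type*} [Field K] [AddCommGroup V] [Module K V]
    (e e' : ι → V) (u : ι → K) (hu : ∀ i, u i ≠ 0) (h : ∀ i, e' i = u i • e i) (S : Set ι) :
    Submodule.span K (e '' S) = Submodule.span K (e' '' S) := by
  apply le_antisymm <;> rw [Submodule.span_le] <;> rintro _ ⟨k, hk, rfl⟩
  · have : e k = (u k)⁻¹ • e' k := by rw [h, smul_smul, inv_mul_cancel₀ (hu k), one_smul]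
    rw [this]
    exact Submodule.smul_mem _ _ (Submodule.subset_span ⟨k, hk, rfl⟩)
  · rw [h]
    exact Submodule.smul_mem _ _ (Submodule.subset_span ⟨k, hk, rfl⟩)

open Classical in
/-- The standard line (`true`) or hyperplane (`false`) attached to a basis and a subset. -/
noncomputable def stdSub {K V : Type*} [Field K] [AddCommGroup V] [Module K V] {n : ℕ}
    (e : Basis (Fin n) K V) (U : Set (Fin n)) : Bool → Submodule K V
  | true => Submodule.span K {∑ k, (if k ∈ U then (1 : K) else 0) • e k}
  | false => LinearMap.ker (e.constr K (fun k => if k ∈ U then (1 : K) else 0))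

/-- The standard triple. -/
noncomputable def stdTriple {K V : Type*} [Field K] [AddCommGroup V] [Module K V] {n p q : ℕ}
    (e : Basis (Fin n) K V)
    (d : (Fin p → Set (Fin n)) × (Fin q → Set (Fin n)) × Set (Fin n) × Bool) :
    (Fin p → Submodule K V) × (Fin q → Submodule K V) × Submodule K V :=
  (fun i => Submodule.span K (e '' d.1 i), fun j => Submodule.span K (e '' d.2.1 j),
    stdSub e d.2.2.1 d.2.2.2)

lemma map_span_basis {K V : Type*} [Field K] [AddCommGroup V] [Module K V] {n : ℕ}
    (e e' : Basis (Fin n) K V) (S : Set (Fin n)) :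
    (Submodule.span K (e '' S)).map (e.equiv e' (Equiv.refl _)).toLinearMap
      = Submodule.span K (e' '' S) := by
  rw [Submodule.map_span, Set.image_image]
  congr 1
  apply Set.image_congr
  intro k _
  simp

lemma map_stdSub {K V : Type*} [Field K] [AddCommGroup V] [Module K V] {n : ℕ}
    (e e' : Basis (Fin n) K V) (U : Set (Fin n)) (t : Bool) :
    (stdSub e U t).map (e.equiv e' (Equiv.refl _)).toLinearMap = stdSub e' U t := by
  classical
  cases t
  · simp only [stdSub]
    ext x
    rw [Submodule.mem_map_equiv, LinearMap.mem_ker, LinearMap.mem_ker]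
    have : (e.constr K (fun k => if k ∈ U then (1 : K) else 0)) ∘ₗ
        (e.equiv e' (Equiv.refl _)).symm.toLinearMap =
        (e'.constr K (fun k => if k ∈ U then (1 : K) else 0)) := by
      apply e'.ext
      intro k
      simp [Basis.constr_basis]
    rw [← this]
    rfl
  · simp only [stdSub]
    rw [Submodule.map_span, Set.image_singleton]
    congr 2
    rw [map_sum]
    refine Finset.sum_congr rfl fun k _ => ?_
    rw [map_smul]
    simp

lemma exists_std {K V : Type*} [Field K] [AddCommGroup V] [Module K V] [FiniteDimensional K V]
    {n c : ℕ} (hn : finrank K V = n) (hc : c = 1 ∨ c = n - 1) (e : Basis (Fin n) K V)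
    (L : Submodule K V) (hL : finrank K L = c) :
    ∃ (e' : Basis (Fin n) K V) (u : Fin n → K) (U : Set (Fin n)) (t : Bool),
      (∀ i, u i ≠ 0) ∧ (∀ i, e' i = u i • e i) ∧ L = stdSub e' U t := by
  classical
  have hspan : ∀ v : V, ∃ (e' : Basis (Fin n) K V) (u : Fin n → K) (U : Set (Fin n)) (t : Bool),
      (∀ i, u i ≠ 0) ∧ (∀ i, e' i = u i • e i) ∧ Submodule.span K {v} = stdSub e' U t := by
    intro v
    let u : Fin n → K := fun i => if e.repr v i = 0 then 1 else e.repr v i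
    have hu : ∀ i, u i ≠ 0 := by
      intro i
      simp only [u]
      split_ifs with h
      · exact one_ne_zero
      · exact h
    refine ⟨e.isUnitSMul (w := u) (fun i => (hu i).isUnit), u, {i | e.repr v i ≠ 0}, true, hu,
      fun i => by simp [Basis.isUnitSMul_apply], ?_⟩
    simp only [stdSub]
    congr 2
    conv_lhs => rw [← e.sum_repr v]
    refine Finset.sum_congr rfl fun k _ => ?_
    by_cases h : e.repr v k = 0 <;> simp [h, Basis.isUnitSMul_apply, u]
  have hker : ∀ f : V →ₗ[K] K,
      ∃ (e' : Basis (Fin n) K V) (u : Fin n → K) (U : Set (Fin n)) (t : Bool),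
      (∀ i, u i ≠ 0) ∧ (∀ i, e' i = u i • e i) ∧ LinearMap.ker f = stdSub e' U t := by
    intro f
    let u : Fin n → K := fun i => if f (e i) = 0 then 1 else (f (e i))⁻¹
    have hu : ∀ i, u i ≠ 0 := by
      intro i
      simp only [u]
      split_ifs with h
      · exact one_ne_zero
      · exact inv_ne_zero h
    refine ⟨e.isUnitSMul (w := u) (fun i => (hu i).isUnit), u, {i | f (e i) ≠ 0}, false, hu,
      fun i => by simp [Basis.isUnitSMul_apply], ?_⟩
    simp only [stdSub]
    congr 1
    apply (e.isUnitSMul (w := u) (fun i => (hu i).isUnit)).ext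
    intro k
    rw [Basis.constr_basis]
    by_cases h : f (e k) = 0 <;> simp [h, Basis.isUnitSMul_apply, u]
  rcases hc with rfl | rfl
  · obtain ⟨v, -, hv⟩ := finrank_eq_one_iff'.1 hL
    have : L = Submodule.span K {(v : V)} := by
      apply le_antisymm
      · intro x hx
        obtain ⟨r, hr⟩ := hv ⟨x, hx⟩
        exact Submodule.mem_span_singleton.2 ⟨r, congrArg Subtype.val hr⟩
      · simp
    rw [this]; exact hspan v
  · by_cases h0 : n = 0
    · have : L = Submodule.span K {0} := by
        rw [Submodule.span_zero_singleton]
        apply Submodule.finrank_eq_zero.1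
        omega
      rw [this]; exact hspan 0
    · have hlt : L < ⊤ := by
        rw [lt_top_iff_ne_top]
        rintro rfl
        rw [finrank_top] at hL
        omega
      obtain ⟨f, hf0, hf⟩ := L.exists_le_ker_of_lt_top hlt
      have : L = LinearMap.ker f := by
        apply Submodule.eq_of_le_of_finrank_le hf
        have h1 := LinearMap.finrank_range_add_finrank_ker f
        have h2 : finrank K (LinearMap.range f) ≠ 0 := by
          rw [Ne, Submodule.finrank_eq_zero, LinearMap.range_eq_bot]
          exact hf0
        omega
      rw [this]; exact hker f

/-- GL(V) has finitely many orbits on triples consisting of two partial flags and a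
subspace `L` with `dim L ∈ {1, n-1}`. -/
theorem finitely_many_orbits_two_flags_and_minwidth_one_subspace
    (K : Type*) [Field K] [IsAlgClosed K] (V : Type*) [AddCommGroup V] [Module K V]
    [FiniteDimensional K V] (n p q c : ℕ) (hn : finrank K V = n)
    (a : Fin p → ℕ) (b : Fin q → ℕ) (ha : StrictMono a) (hb : StrictMono b)
    (ha0 : ∀ i, 0 < a i) (han : ∀ i, a i < n)
    (hb0 : ∀ j, 0 < b j) (hbn : ∀ j, b j < n)
    (hc : c = 1 ∨ c = n - 1) :
    { O : Set ((Fin p → Submodule K V) × (Fin q → Submodule K V) × Submodule K V) |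
        ∃ x : (Fin p → Submodule K V) × (Fin q → Submodule K V) × Submodule K V,
          (Monotone x.1 ∧ Monotone x.2.1 ∧
            (∀ i, finrank K (x.1 i) = a i) ∧ (∀ j, finrank K (x.2.1 j) = b j) ∧
            finrank K x.2.2 = c) ∧
          O = { x' | ∃ g : V ≃ₗ[K] V,
            (∀ i, (x.1 i).map g.toLinearMap = x'.1 i) ∧
            (∀ j, (x.2.1 j).map g.toLinearMap = x'.2.1 j) ∧
            x.2.2.map g.toLinearMap = x'.2.2 } }.Finite := by
  classical
  let e0 : Basis (Fin n) K V := finBasisOfFinrankEq K V hn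
  refine (Set.finite_range (fun d : (Fin p → Set (Fin n)) × (Fin q → Set (Fin n)) ×
      Set (Fin n) × Bool =>
    ({ x' | ∃ g : V ≃ₗ[K] V,
            (∀ i, ((stdTriple e0 d).1 i).map g.toLinearMap = x'.1 i) ∧
            (∀ j, ((stdTriple e0 d).2.1 j).map g.toLinearMap = x'.2.1 j) ∧
            (stdTriple e0 d).2.2.map g.toLinearMap = x'.2.2 } :
      Set ((Fin p → Submodule K V) × (Fin q → Submodule K V) × Submodule K V)))).subset ?_
  rintro O ⟨⟨A, B, L⟩, ⟨hA, hB, -, -, hL⟩, rfl⟩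
  simp only at hA hB hL
  obtain ⟨e, heA, heB⟩ := adapted_basis n hn (Set.range A) (Set.range B)
    hA.isChain_range hB.isChain_range
  obtain ⟨e', u, U, t, hu, he', hLU⟩ := exists_std hn hc e L hL
  choose S hS using fun i => heA (A i) ⟨i, rfl⟩
  choose T hT using fun j => heB (B j) ⟨j, rfl⟩
  let g0 := e0.equiv e' (Equiv.refl _)
  have h1 : ∀ i, (Submodule.span K (e0 '' S i)).map g0.toLinearMap = A i := fun i => by
    rw [map_span_basis, hS i, span_scaled e e' u hu he']
  have h2 : ∀ j, (Submodule.span K (e0 '' T j)).map g0.toLinearMap = B j := fun j => by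
    rw [map_span_basis, hT j, span_scaled e e' u hu he']
  have h3 : (stdSub e0 U t).map g0.toLinearMap = L := by rw [map_stdSub, hLU]
  have hcomp : ∀ (X : Submodule K V) (g : V ≃ₗ[K] V),
      X.map (g0.trans g).toLinearMap = (X.map g0.toLinearMap).map g.toLinearMap := by
    intro X g
    rw [← Submodule.map_comp]; rfl
  refine ⟨(S, T, U, t), ?_⟩
  ext ⟨A', B', L'⟩
  simp only [stdTriple, Set.mem_setOf_eq]
  constructor
  · rintro ⟨g, ga, gb, gl⟩
    have hg : g0.trans (g0.symm.trans g) = g := by ext; simp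
    refine ⟨g0.symm.trans g, fun i => ?_, fun j => ?_, ?_⟩
    · rw [← h1, ← hcomp, hg, ga]
    · rw [← h2, ← hcomp, hg, gb]
    · rw [← h3, ← hcomp, hg, gl]
  · rintro ⟨g, ga, gb, gl⟩
    refine ⟨g0.trans g, fun i => ?_, fun j => ?_, ?_⟩
    · rw [hcomp, h1, ga]
    · rw [hcomp, h2, gb]
    · rw [hcomp, h3, gl]
end

section
/- Let K be an algebraically closed field and V a K-vector space of dimension n. Fix an integer ℓ with 1 ≤ ℓ ≤ 4 and dimension types 0 < a < n, 0 < b_1 < b_2 < n, and 0 < c_1 < ... < c_ℓ < n. Then the GL(V)-action on triples (A, B_1 ⊆ B_2, C_1 ⊆ ... ⊆ C_ℓ), where A is a subspace of dimension a, (B_1, B_2) is a partial flag of type (b_1, b_2), and (C_1, ..., C_ℓ) is a partial flag of type (c_1, ..., c_ℓ), has finitely many orbits. -/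
open Module

namespace E8

universe u v

/-- subspace orientation of the star with branches `1`, `2 → 3`, `4 → 5 → 6 → 7`. -/
def o0 (a b : Fin 8) : Bool :=
  ((a, b) ∈ ([(1,0),(2,3),(3,0),(4,5),(5,6),(6,7),(7,0)] : List (Fin 8 × Fin 8)))

def adj (a b : Fin 8) : Bool := o0 a b || o0 b a

def sig (i : Fin 8) (o : Fin 8 → Fin 8 → Bool) (a b : Fin 8) : Bool :=
  if a = i then adj i b else if b = i then false else o a b

def Sink (o : Fin 8 → Fin 8 → Bool) (i : Fin 8) : Prop :=
  (∀ b, o i b = false) ∧ (∀ a, adj i a = false → o a i = false)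

def Adm : (Fin 8 → Fin 8 → Bool) → List (Fin 8) → Prop
  | _, [] => True
  | o, i :: w => Sink o i ∧ Adm (sig i o) w

def rnd : List (Fin 8) := [0,1,3,2,7,6,5,4]

def word : ℕ → List (Fin 8)
  | 0 => []
  | n + 1 => rnd ++ word n

def sr (i : Fin 8) (d : Fin 8 → ℤ) : Fin 8 → ℤ :=
  Function.update d i ((∑ k, if adj i k then d k else 0) - d i)

def sw : List (Fin 8) → (Fin 8 → ℤ) → (Fin 8 → ℤ)
  | [], d => d
  | i :: w, d => sr i (sw w d)

lemma adm_word (n : ℕ) : Adm o0 (word n) := by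
  induction n with
  | zero => trivial
  | succ n ih =>
    have h : sig 4 (sig 5 (sig 6 (sig 7 (sig 2 (sig 3 (sig 1 (sig 0 o0))))))) = o0 := by
      funext a b; revert a b; decide
    simp only [word, rnd, List.cons_append, List.nil_append, Adm]
    rw [h]
    unfold Sink
    refine ⟨by decide, by decide, by decide, by decide, by decide, by decide, by decide,
      by decide, ih⟩

lemma sw_append (w w' : List (Fin 8)) (d) : sw (w ++ w') d = sw w (sw w' d) := by
  induction w with
  | nil => rfl
  | cons i w ih => simp [sw, ih]

def srM (i : Fin 8) : Matrix (Fin 8) (Fin 8) ℤ := fun a b =>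
  if a = i then (if adj i b then 1 else 0) - (if b = i then 1 else 0) else if a = b then 1 else 0

lemma sr_eq (i : Fin 8) (d) : sr i d = (srM i).mulVec d := by
  funext a
  by_cases h : a = i
  · subst h
    simp [sr, Matrix.mulVec, dotProduct, srM, sub_mul, Finset.sum_sub_distrib]
  · simp [sr, Matrix.mulVec, dotProduct, srM, h]

def cox : Matrix (Fin 8) (Fin 8) ℤ :=
  srM 0 * (srM 1 * (srM 3 * (srM 2 * (srM 7 * (srM 6 * (srM 5 * srM 4))))))

lemma sw_rnd (d) : sw rnd d = cox.mulVec d := by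
  simp [rnd, sw, sr_eq, cox, Matrix.mulVec_mulVec]

lemma sw_word (n : ℕ) (d) : sw (word n) d = (cox ^ n).mulVec d := by
  induction n with
  | zero => simp [word, sw]
  | succ n ih => rw [word, sw_append, ih, sw_rnd, Matrix.mulVec_mulVec, pow_succ']

def cx0 : Matrix (Fin 8) (Fin 8) ℤ := Matrix.of ![
  ![1, 0, 0, 0, 0, 0, 0, 0],
  ![0, 1, 0, 0, 0, 0, 0, 0],
  ![0, 0, 1, 0, 0, 0, 0, 0],
  ![0, 0, 0, 1, 0, 0, 0, 0],
  ![0, 0, 0, 0, -1, 1, 0, 0],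
  ![0, 0, 0, 0, -1, 0, 1, 0],
  ![0, 0, 0, 0, 0, 0, 1, 0],
  ![0, 0, 0, 0, 0, 0, 0, 1]]

lemma cx0_eq : srM 5 * srM 4 = cx0 := by decide +kernel

def cx1 : Matrix (Fin 8) (Fin 8) ℤ := Matrix.of ![
  ![1, 0, 0, 0, 0, 0, 0, 0],
  ![0, 1, 0, 0, 0, 0, 0, 0],
  ![0, 0, 1, 0, 0, 0, 0, 0],
  ![0, 0, 0, 1, 0, 0, 0, 0],
  ![0, 0, 0, 0, -1, 1, 0, 0],
  ![0, 0, 0, 0, -1, 0, 1, 0],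
  ![0, 0, 0, 0, -1, 0, 0, 1],
  ![0, 0, 0, 0, 0, 0, 0, 1]]

lemma cx1_eq : srM 6 * cx0 = cx1 := by decide +kernel

def cx2 : Matrix (Fin 8) (Fin 8) ℤ := Matrix.of ![
  ![1, 0, 0, 0, 0, 0, 0, 0],
  ![0, 1, 0, 0, 0, 0, 0, 0],
  ![0, 0, 1, 0, 0, 0, 0, 0],
  ![0, 0, 0, 1, 0, 0, 0, 0],
  ![0, 0, 0, 0, -1, 1, 0, 0],
  ![0, 0, 0, 0, -1, 0, 1, 0],
  ![0, 0, 0, 0, -1, 0, 0, 1],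
  ![1, 0, 0, 0, -1, 0, 0, 0]]

lemma cx2_eq : srM 7 * cx1 = cx2 := by decide +kernel

def cx3 : Matrix (Fin 8) (Fin 8) ℤ := Matrix.of ![
  ![1, 0, 0, 0, 0, 0, 0, 0],
  ![0, 1, 0, 0, 0, 0, 0, 0],
  ![0, 0, -1, 1, 0, 0, 0, 0],
  ![0, 0, 0, 1, 0, 0, 0, 0],
  ![0, 0, 0, 0, -1, 1, 0, 0],
  ![0, 0, 0, 0, -1, 0, 1, 0],
  ![0, 0, 0, 0, -1, 0, 0, 1],
  ![1, 0, 0, 0, -1, 0, 0, 0]]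

lemma cx3_eq : srM 2 * cx2 = cx3 := by decide +kernel

def cx4 : Matrix (Fin 8) (Fin 8) ℤ := Matrix.of ![
  ![1, 0, 0, 0, 0, 0, 0, 0],
  ![0, 1, 0, 0, 0, 0, 0, 0],
  ![0, 0, -1, 1, 0, 0, 0, 0],
  ![1, 0, -1, 0, 0, 0, 0, 0],
  ![0, 0, 0, 0, -1, 1, 0, 0],
  ![0, 0, 0, 0, -1, 0, 1, 0],
  ![0, 0, 0, 0, -1, 0, 0, 1],
  ![1, 0, 0, 0, -1, 0, 0, 0]]

lemma cx4_eq : srM 3 * cx3 = cx4 := by decide +kernel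

def cx5 : Matrix (Fin 8) (Fin 8) ℤ := Matrix.of ![
  ![1, 0, 0, 0, 0, 0, 0, 0],
  ![1, -1, 0, 0, 0, 0, 0, 0],
  ![0, 0, -1, 1, 0, 0, 0, 0],
  ![1, 0, -1, 0, 0, 0, 0, 0],
  ![0, 0, 0, 0, -1, 1, 0, 0],
  ![0, 0, 0, 0, -1, 0, 1, 0],
  ![0, 0, 0, 0, -1, 0, 0, 1],
  ![1, 0, 0, 0, -1, 0, 0, 0]]

lemma cx5_eq : srM 1 * cx4 = cx5 := by decide +kernel

def mc1 : Matrix (Fin 8) (Fin 8) ℤ := Matrix.of ![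
  ![2, -1, -1, 0, -1, 0, 0, 0],
  ![1, -1, 0, 0, 0, 0, 0, 0],
  ![0, 0, -1, 1, 0, 0, 0, 0],
  ![1, 0, -1, 0, 0, 0, 0, 0],
  ![0, 0, 0, 0, -1, 1, 0, 0],
  ![0, 0, 0, 0, -1, 0, 1, 0],
  ![0, 0, 0, 0, -1, 0, 0, 1],
  ![1, 0, 0, 0, -1, 0, 0, 0]]

lemma mc1_eq : srM 0 * cx5 = mc1 := by decide +kernel

def mc2 : Matrix (Fin 8) (Fin 8) ℤ := Matrix.of ![
  ![3, -1, -1, -1, -1, -1, 0, 0],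
  ![1, 0, -1, 0, -1, 0, 0, 0],
  ![1, 0, 0, -1, 0, 0, 0, 0],
  ![2, -1, 0, -1, -1, 0, 0, 0],
  ![0, 0, 0, 0, 0, -1, 1, 0],
  ![0, 0, 0, 0, 0, -1, 0, 1],
  ![1, 0, 0, 0, 0, -1, 0, 0],
  ![2, -1, -1, 0, 0, -1, 0, 0]]

lemma mc2_eq : mc1 * mc1 = mc2 := by decide +kernel

def mc4 : Matrix (Fin 8) (Fin 8) ℤ := Matrix.of ![
  ![5, -2, -2, -1, -1, -1, -1, -1],
  ![2, -1, -1, 0, -1, 0, -1, 0],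
  ![1, 0, -1, 0, 0, -1, 0, 0],
  ![3, -1, -1, -1, 0, -1, -1, 0],
  ![1, 0, 0, 0, 0, 0, 0, -1],
  ![2, -1, -1, 0, 0, 0, 0, -1],
  ![3, -1, -1, -1, -1, 0, 0, -1],
  ![4, -2, -1, -1, -1, -1, 0, -1]]

lemma mc4_eq : mc2 * mc2 = mc4 := by decide +kernel

def mc5 : Matrix (Fin 8) (Fin 8) ℤ := Matrix.of ![
  ![6, -3, -2, -2, -1, -1, -1, -1],
  ![3, -1, -1, -1, 0, -1, 0, -1],
  ![2, -1, 0, -1, 0, 0, -1, 0],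
  ![4, -2, -1, -1, -1, 0, -1, -1],
  ![1, -1, -1, 0, 0, 0, 0, 0],
  ![2, -1, -1, -1, -1, 0, 0, 0],
  ![3, -2, -1, -1, -1, -1, 0, 0],
  ![4, -2, -2, -1, -1, -1, -1, 0]]

lemma mc5_eq : mc4 * mc1 = mc5 := by decide +kernel

def mc10 : Matrix (Fin 8) (Fin 8) ℤ := Matrix.of ![
  ![5, -3, -2, -2, -1, -1, -1, -1],
  ![3, -2, -1, -1, 0, -1, 0, -1],
  ![2, -1, -1, -1, 0, 0, -1, 0],
  ![4, -2, -1, -2, -1, 0, -1, -1],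
  ![1, -1, -1, 0, -1, 0, 0, 0],
  ![2, -1, -1, -1, -1, -1, 0, 0],
  ![3, -2, -1, -1, -1, -1, -1, 0],
  ![4, -2, -2, -1, -1, -1, -1, -1]]

lemma mc10_eq : mc5 * mc5 = mc10 := by decide +kernel

lemma mc15_eq : mc10 * mc5 = -1 := by decide +kernel

lemma cox15 : cox ^ 15 = -1 := by
  have h : cox = mc1 := by
    rw [cox, cx0_eq, cx1_eq, cx2_eq, cx3_eq, cx4_eq, cx5_eq, mc1_eq]
  rw [h, ← mc15_eq, ← mc10_eq, ← mc5_eq, ← mc4_eq, ← mc2_eq]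
  noncomm_ring

lemma sw_final (d) : sw (word 15) d = -d := by
  rw [sw_word, cox15]; simp [Matrix.neg_mulVec]


structure Rep (K : Type v) [Field K] where
  M : Fin 8 → Type u
  [acg : ∀ i, AddCommGroup (M i)]
  [mod : ∀ i, Module K (M i)]
  [fd : ∀ i, FiniteDimensional K (M i)]
  φ : ∀ i j, M i →ₗ[K] M j

attribute [instance] Rep.acg Rep.mod Rep.fd

section
variable {K : Type v} [Field K]

def Supp (o : Fin 8 → Fin 8 → Bool) (X : Rep.{u} K) : Prop :=
  ∀ a b, o a b = false → X.φ a b = 0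

def Iso (X Y : Rep.{u} K) : Prop :=
  ∃ e : ∀ j, X.M j →ₗ[K] Y.M j, (∀ j, Function.Bijective (e j)) ∧
    ∀ a b x, e b (X.φ a b x) = Y.φ a b (e a x)

noncomputable def dm (X : Rep.{u} K) (j : Fin 8) : ℤ := finrank K (X.M j)

/-- the summation map into the vertex `i`. -/
def inn (X : Rep.{u} K) (i : Fin 8) : (∀ k, X.M k) →ₗ[K] X.M i :=
  ∑ k, X.φ k i ∘ₗ LinearMap.proj k

lemma inn_apply (X : Rep.{u} K) (i : Fin 8) (y) : inn X i y = ∑ k, X.φ k i (y k) := by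
  simp [inn]

def S (X : Rep.{u} K) (i j : Fin 8) : Submodule K (X.M j × (∀ k, X.M k)) where
  carrier := {p | (j = i → p.1 = 0 ∧ (∀ k, adj i k = false → p.2 k = 0) ∧ inn X i p.2 = 0) ∧
    (j ≠ i → p.2 = 0)}
  zero_mem' := by simp
  add_mem' := by
    rintro ⟨x, y⟩ ⟨x', y'⟩ ⟨h1, h2⟩ ⟨h1', h2'⟩
    refine ⟨fun h => ?_, fun h => ?_⟩
    · obtain ⟨a, b, c⟩ := h1 h
      obtain ⟨a', b', c'⟩ := h1' h
      simp only at a b c a' b' c'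
      refine ⟨by simp [a, a'], fun k hk => by simp [b k hk, b' k hk], by simp [c, c']⟩
    · have := h2 h
      have := h2' h
      simp_all
  smul_mem' := by
    rintro r ⟨x, y⟩ ⟨h1, h2⟩
    refine ⟨fun h => ?_, fun h => ?_⟩
    · obtain ⟨a, b, c⟩ := h1 h
      simp only at a b c
      refine ⟨by simp [a], fun k hk => by simp [b k hk], by simp [c]⟩
    · have := h2 h
      simp_all

def rmap (X : Rep.{u} K) (i a b : Fin 8) : S X i a →ₗ[K] S X i b :=
  if h : b = i then 0 else
    LinearMap.codRestrict (S X i b)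
      ((LinearMap.inl K (X.M b) (∀ k, X.M k) ∘ₗ
        (X.φ a b ∘ₗ LinearMap.fst K _ _ + LinearMap.proj b ∘ₗ LinearMap.snd K _ _)) ∘ₗ
        (S X i a).subtype)
      (fun _ => ⟨fun h' => absurd h' h, fun _ => rfl⟩)

def refl (i : Fin 8) (X : Rep.{u} K) : Rep.{u} K where
  M j := S X i j
  φ a b := rmap X i a b

/-- first coordinate. -/
def pr (X : Rep.{u} K) (i j : Fin 8) : (refl i X).M j →ₗ[K] X.M j :=
  LinearMap.fst K _ _ ∘ₗ (S X i j).subtype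

/-- second coordinate. -/
def kap (X : Rep.{u} K) (i : Fin 8) : (refl i X).M i →ₗ[K] (∀ k, X.M k) :=
  LinearMap.snd K _ _ ∘ₗ (S X i i).subtype

def io (X : Rep.{u} K) (i j : Fin 8) : X.M j →ₗ[K] (refl i X).M j :=
  if h : j = i then 0 else
    LinearMap.codRestrict (S X i j) (LinearMap.inl K _ _)
      (fun _ => ⟨fun h' => absurd h' h, fun _ => rfl⟩)

lemma pr_io (X : Rep.{u} K) {i j : Fin 8} (h : j ≠ i) (x) : pr X i j (io X i j x) = x := by
  simp [pr, io, h]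
  rfl

lemma io_pr (X : Rep.{u} K) {i j : Fin 8} (h : j ≠ i) (x) : io X i j (pr X i j x) = x := by
  obtain ⟨⟨x, y⟩, h1, h2⟩ := x
  apply Subtype.ext
  have := h2 h
  simp only at this
  simp [pr, io, h, this]
  rfl

lemma refl_phi_sink (X : Rep.{u} K) (i a : Fin 8) : (refl i X).φ a i = 0 := by
  simp [refl, rmap]
  rfl

lemma pr_phi (X : Rep.{u} K) {i a b : Fin 8} (ha : a ≠ i) (hb : b ≠ i) (x) :
    pr X i b ((refl i X).φ a b x) = X.φ a b (pr X i a x) := by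
  obtain ⟨⟨x, y⟩, h1, h2⟩ := x
  have := h2 ha
  simp only at this
  subst this
  simp [pr, refl, rmap, hb]
  exact add_zero _

lemma pr_phi_i (X : Rep.{u} K) {i b : Fin 8} (hb : b ≠ i) (x) :
    pr X i b ((refl i X).φ i b x) = kap X i x b := by
  obtain ⟨⟨x, y⟩, h1, h2⟩ := x
  have := (h1 rfl).1
  simp only at this
  subst this
  simp [pr, refl, rmap, hb, kap]
  refine Eq.trans (congrArg (· + y b) (map_zero (X.φ i b))) (zero_add _)

lemma kap_inj (X : Rep.{u} K) (i : Fin 8) : Function.Injective (kap X i) := by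
  rintro ⟨⟨x, y⟩, h1, h2⟩ ⟨⟨x', y'⟩, h1', h2'⟩ h
  have := (h1 rfl).1
  have := (h1' rfl).1
  simp only at *
  apply Subtype.ext
  have h3 : y = y' := h
  simp_all

lemma kap_adj (X : Rep.{u} K) (i : Fin 8) (z) (k) (h : adj i k = false) : kap X i z k = 0 :=
  (z.2.1 rfl).2.1 k h

lemma inn_kap (X : Rep.{u} K) (i : Fin 8) (z) : inn X i (kap X i z) = 0 :=
  (z.2.1 rfl).2.2

lemma exists_kap (X : Rep.{u} K) (i : Fin 8) (y : ∀ k, X.M k)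
    (h : ∀ k, adj i k = false → y k = 0) (h' : inn X i y = 0) : ∃ z, kap X i z = y :=
  ⟨⟨(0, y), ⟨fun _ => ⟨rfl, h, h'⟩, fun h => absurd rfl h⟩⟩, rfl⟩

lemma supp_refl {o : Fin 8 → Fin 8 → Bool} {X : Rep.{u} K} (hX : Supp o X) (i : Fin 8) :
    Supp (sig i o) (refl i X) := by
  intro a b h
  by_cases hb : b = i
  · subst hb; exact refl_phi_sink X b a
  ext1 x
  have hinj : Function.Injective (pr X i b) :=
    Function.LeftInverse.injective (io_pr X hb)
  apply hinj
  by_cases ha : a = i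
  · subst ha
    rw [pr_phi_i X hb, kap_adj]
    · simp
    · simpa [sig] using h
  · rw [pr_phi X ha hb, hX a b]
    · simp
    · simpa [sig, ha, hb] using h

lemma dm_refl_ne (X : Rep.{u} K) {i j : Fin 8} (h : j ≠ i) : dm (refl i X) j = dm X j := by
  unfold dm
  congr 1
  exact LinearEquiv.finrank_eq (LinearEquiv.ofLinearMap (pr X i j) (io X i j)
    (LinearMap.ext (pr_io X h)) (LinearMap.ext (io_pr X h)))

lemma inn_eq_zero_of_adj {X : Rep.{u} K} {o : Fin 8 → Fin 8 → Bool} (hX : Supp o X) {i : Fin 8}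
    (hs : Sink o i) (y y' : ∀ k, X.M k) (h : ∀ k, adj i k = true → y k = y' k) :
    inn X i y = inn X i y' := by
  rw [inn_apply, inn_apply]
  refine Finset.sum_congr rfl fun k _ => ?_
  cases hk : adj i k
  · rw [hX k i (hs.2 k hk)]; simp
  · rw [h k hk]

lemma exists_ginv {P A : Type*} [AddCommGroup P] [Module K P] [AddCommGroup A] [Module K A]
    (f : P →ₗ[K] A) : ∃ g : A →ₗ[K] P, ∀ y, f (g (f y)) = f y := by
  obtain ⟨s, hs⟩ := f.rangeRestrict.exists_rightInverse_of_surjective f.range_rangeRestrict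
  obtain ⟨r, hr⟩ := (LinearMap.range f).subtype.exists_leftInverse_of_injective
    (Submodule.ker_subtype _)
  refine ⟨s ∘ₗ r, fun y => ?_⟩
  have h1 : r (f y) = f.rangeRestrict y := LinearMap.congr_fun hr (f.rangeRestrict y)
  have h2 := LinearMap.congr_fun hs (f.rangeRestrict y)
  simp only [LinearMap.comp_apply, h1]
  exact congrArg Subtype.val h2

lemma exists_equiv {P A B : Type*} [AddCommGroup P] [Module K P] [AddCommGroup A] [Module K A]
    [AddCommGroup B] [Module K B] [FiniteDimensional K A] [FiniteDimensional K B]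
    (f : P →ₗ[K] A) (g : P →ₗ[K] B) (hk : ∀ y, f y = 0 ↔ g y = 0)
    (hd : finrank K A = finrank K B) :
    ∃ θ : A →ₗ[K] B, Function.Bijective θ ∧ ∀ y, θ (f y) = g y := by
  obtain ⟨C, hC⟩ := (LinearMap.range f).exists_isCompl
  obtain ⟨D, hD⟩ := (LinearMap.range g).exists_isCompl
  have hker : LinearMap.ker f = LinearMap.ker g := by ext y; simp [hk]
  let e : LinearMap.range f ≃ₗ[K] LinearMap.range g :=
    f.quotKerEquivRange.symm ≪≫ₗ Submodule.quotEquivOfEq _ _ hker ≪≫ₗ g.quotKerEquivRange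
  have hCD : finrank K C = finrank K D := by
    have h1 := Submodule.finrank_add_eq_of_isCompl hC
    have h2 := Submodule.finrank_add_eq_of_isCompl hD
    have h3 := e.finrank_eq
    omega
  let c : C ≃ₗ[K] D := LinearEquiv.ofFinrankEq _ _ hCD
  let θ := (Submodule.prodEquivOfIsCompl _ _ hC).symm ≪≫ₗ (e.prodCongr c) ≪≫ₗ
    (Submodule.prodEquivOfIsCompl _ _ hD)
  refine ⟨θ.toLinearMap, θ.bijective, fun y => ?_⟩
  have h1 : (Submodule.prodEquivOfIsCompl _ _ hC).symm (f y) = (f.rangeRestrict y, 0) := by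
    rw [LinearEquiv.symm_apply_eq]; simp
  have h2 : f.quotKerEquivRange.symm (f.rangeRestrict y) = Submodule.Quotient.mk y := by
    rw [LinearEquiv.symm_apply_eq]; rfl
  simp only [θ, LinearEquiv.coe_coe, LinearEquiv.trans_apply, h1, LinearEquiv.prodCongr_apply, e, h2]
  simp

lemma adj_self (i : Fin 8) : adj i i = false := by revert i; decide

lemma iso_of_refl {o : Fin 8 → Fin 8 → Bool} {X Y : Rep.{u} K} (hX : Supp o X) (hY : Supp o Y)
    {i : Fin 8} (hs : Sink o i) (hd : finrank K (X.M i) = finrank K (Y.M i))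
    (h : Iso (refl i X) (refl i Y)) : Iso X Y := by
  obtain ⟨e, he, hc⟩ := h
  let p : ∀ j, X.M j →ₗ[K] Y.M j := fun j => pr Y i j ∘ₗ e j ∘ₗ io X i j
  let E : (∀ k, X.M k) →ₗ[K] (∀ k, Y.M k) := LinearMap.pi fun k => p k ∘ₗ LinearMap.proj k
  have hEk : ∀ z k, k ≠ i → E (kap X i z) k = kap Y i (e i z) k := by
    intro z k hk
    rw [← pr_phi_i Y hk, ← hc, ← io_pr X hk ((refl i X).φ i k z), pr_phi_i X hk]
    rfl
  have hii : adj i i = false := adj_self i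
  have hne : ∀ k, adj i k = true → k ≠ i := by rintro k hk rfl; simp [hii] at hk
  have hpb : ∀ j, j ≠ i → Function.Bijective (p j) := by
    intro j hj
    have h1 : Function.Bijective (pr Y i j) :=
      Function.bijective_iff_has_inverse.2 ⟨_, io_pr Y hj, pr_io Y hj⟩
    have h2 : Function.Bijective (io X i j) :=
      Function.bijective_iff_has_inverse.2 ⟨_, pr_io X hj, io_pr X hj⟩
    exact h1.comp ((he j).comp h2)
  have hker : ∀ y, inn X i y = 0 ↔ (inn Y i ∘ₗ E) y = 0 := by
    intro y
    let y' : ∀ k, X.M k := fun k => if adj i k then y k else 0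
    constructor
    · intro hy
      have hy' : inn X i y' = 0 := by
        rw [← hy]; apply inn_eq_zero_of_adj hX hs; intro k hk; simp [y', hk]
      obtain ⟨z, hz⟩ := exists_kap X i y' (fun k hk => by simp [y', hk]) hy'
      rw [← inn_kap Y i (e i z)]
      apply inn_eq_zero_of_adj hY hs
      intro k hk
      rw [← hEk z k (hne k hk), hz]
      simp [E, y', hk]
    · intro hy
      have hy' : inn Y i (fun k => if adj i k then E y k else 0) = 0 := by
        rw [← hy]; apply inn_eq_zero_of_adj hY hs; intro k hk; simp [hk]
      obtain ⟨z, hz⟩ := exists_kap Y i _ (fun k hk => by simp [hk]) hy'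
      obtain ⟨z, rfl⟩ := (he i).2 z
      rw [← inn_kap X i z]
      apply inn_eq_zero_of_adj hX hs
      intro k hk
      apply (hpb k (hne k hk)).1
      have h1 := hEk z k (hne k hk)
      rw [hz] at h1
      simp only [hk, if_true] at h1
      exact h1.symm
  obtain ⟨θ, hθ, hθf⟩ := exists_equiv (inn X i) (inn Y i ∘ₗ E) hker hd
  refine ⟨Function.update p i θ, fun j => ?_, fun a b x => ?_⟩
  · by_cases hj : j = i
    · subst hj; simpa using hθ
    · simpa [Function.update_of_ne hj] using hpb j hj
  · by_cases ha : a = i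
    · subst ha
      rw [hX a b (hs.1 b), hY a b (hs.1 b)]; simp
    by_cases hb : b = i
    · subst hb
      rw [Function.update_self, Function.update_of_ne ha]
      have h1 := hθf (Pi.single a x)
      have h2 : inn X b (Pi.single a x) = X.φ a b x := by
        rw [inn_apply, Finset.sum_eq_single a]
        · simp
        · intro k _ hk; simp [hk]
        · simp
      have h3 : (inn Y b ∘ₗ E) (Pi.single a x) = Y.φ a b (p a x) := by
        rw [LinearMap.comp_apply, inn_apply, Finset.sum_eq_single a]
        · simp [E]
        · intro k _ hk; simp [E, hk]
        · simp
      rw [← h2, h1, h3]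
    · rw [Function.update_of_ne ha, Function.update_of_ne hb]
      simp only [p, LinearMap.comp_apply]
      rw [← pr_phi Y ha hb, ← hc]
      congr 2
      rw [← io_pr X hb ((refl i X).φ a b _), pr_phi X ha hb, pr_io X ha]


lemma finrank_range_pi (X : Rep.{u} K) (E : ∀ k, X.M k →ₗ[K] X.M k) :
    finrank K (LinearMap.range (LinearMap.pi fun k => E k ∘ₗ LinearMap.proj (φ := X.M) k)) =
      ∑ k, finrank K (LinearMap.range (E k)) := by
  let g : (∀ k, LinearMap.range (E k)) →ₗ[K] (∀ k, X.M k) :=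
    LinearMap.pi fun k => (LinearMap.range (E k)).subtype ∘ₗ LinearMap.proj k
  have hg : Function.Injective g := by
    intro y y' h
    funext k
    exact Subtype.ext (congrFun h k)
  have hr : LinearMap.range (LinearMap.pi fun k => E k ∘ₗ LinearMap.proj (φ := X.M) k) =
      LinearMap.range g := by
    ext y
    constructor
    · rintro ⟨z, rfl⟩
      exact ⟨fun k => ⟨E k (z k), ⟨_, rfl⟩⟩, rfl⟩
    · rintro ⟨z, rfl⟩
      choose w hw using fun k => (z k).2
      exact ⟨w, funext fun k => hw k⟩
  rw [hr, LinearMap.finrank_range_of_inj hg, Module.finrank_pi_fintype]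

lemma finrank_map_add {P A : Type*} [AddCommGroup P] [Module K P] [AddCommGroup A] [Module K A]
    [FiniteDimensional K P] (f : P →ₗ[K] A) (N : Submodule K P) :
    finrank K (N.map f) + finrank K (LinearMap.ker f ⊓ N : Submodule K P) = finrank K N := by
  have h := (f.domRestrict N).finrank_range_add_finrank_ker
  rw [LinearMap.range_domRestrict] at h
  rw [← h, LinearMap.ker_domRestrict, ← Submodule.finrank_map_subtype_eq N,
    Submodule.map_comap_subtype, inf_comm]

lemma finrank_map_inj {P A : Type*} [AddCommGroup P] [Module K P] [AddCommGroup A] [Module K A]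
    (f : P →ₗ[K] A) (hf : Function.Injective f) (N : Submodule K P) :
    finrank K (N.map f) = finrank K N :=
  (Submodule.equivMapOfInjective f hf N).finrank_eq.symm

noncomputable def rk {X : Rep.{u} K} (ε : ∀ j, X.M j →ₗ[K] X.M j) (j : Fin 8) : ℤ :=
  finrank K (LinearMap.range (ε j))

def Idem (X : Rep.{u} K) (ε : ∀ j, X.M j →ₗ[K] X.M j) : Prop :=
  (∀ j x, ε j (ε j x) = ε j x) ∧ ∀ a b x, ε b (X.φ a b x) = X.φ a b (ε a x)

lemma lift {o : Fin 8 → Fin 8 → Bool} {X : Rep.{u} K} (hX : Supp o X) {i : Fin 8}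
    (hs : Sink o i) (ε : ∀ j, (refl i X).M j →ₗ[K] (refl i X).M j) (hε : Idem _ ε) :
    ∃ ε', Idem X ε' ∧ rk ε' = sr i (rk ε) := by
  obtain ⟨hid, hc⟩ := hε
  have hii : adj i i = false := adj_self i
  have hne : ∀ k, adj i k = true → k ≠ i := by rintro k hk rfl; simp [hii] at hk
  let q : ∀ j, X.M j →ₗ[K] X.M j := fun j => pr X i j ∘ₗ ε j ∘ₗ io X i j
  have hq : ∀ j, j ≠ i → ∀ x, q j (q j x) = q j x := by
    intro j hj x
    simp only [q, LinearMap.comp_apply, io_pr X hj, hid]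
  let Ek : ∀ k, X.M k →ₗ[K] X.M k := fun k => if adj i k then q k else 0
  let E : (∀ k, X.M k) →ₗ[K] (∀ k, X.M k) := LinearMap.pi fun k => Ek k ∘ₗ LinearMap.proj k
  have hE1 : ∀ y k, adj i k = true → E y k = q k (y k) := by
    intro y k hk; simp [E, Ek, hk]
  have hE0 : ∀ y k, adj i k = false → E y k = 0 := by
    intro y k hk; simp [E, Ek, hk]
  have hEE : ∀ y, E (E y) = E y := by
    intro y
    funext k
    cases hk : adj i k
    · rw [hE0 _ k hk, hE0 _ k hk]
    · rw [hE1 _ k hk, hE1 _ k hk, hq k (hne k hk)]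
  have hEk : ∀ z, E (kap X i z) = kap X i (ε i z) := by
    intro z
    funext k
    cases hk : adj i k
    · rw [hE0 _ k hk, kap_adj _ _ _ _ hk]
    · have hk' := hne k hk
      rw [hE1 _ k hk, ← pr_phi_i X hk', ← pr_phi_i X hk', ← hc]
      simp only [q, LinearMap.comp_apply, io_pr X hk']
  have hker : ∀ y, inn X i y = 0 → inn X i (E y) = 0 := by
    intro y hy
    let y' : ∀ k, X.M k := fun k => if adj i k then y k else 0
    have hy' : inn X i y' = 0 := by
      rw [← hy]; apply inn_eq_zero_of_adj hX hs; intro k hk; simp [y', hk]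
    obtain ⟨z, hz⟩ := exists_kap X i y' (fun k hk => by simp [y', hk]) hy'
    rw [← inn_kap X i (ε i z), ← hEk, hz]
    apply inn_eq_zero_of_adj hX hs
    intro k hk
    rw [hE1 _ k hk, hE1 _ k hk]
    simp [y', hk]
  obtain ⟨g, hg⟩ := exists_ginv (inn X i)
  let p : X.M i →ₗ[K] X.M i := inn X i ∘ₗ E ∘ₗ g
  have hpf : ∀ y, p (inn X i y) = inn X i (E y) := by
    intro y
    have : inn X i (g (inn X i y) - y) = 0 := by rw [map_sub, hg, sub_self]
    have := hker _ this
    rw [map_sub, map_sub, sub_eq_zero] at this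
    exact this
  have hpp : ∀ x, p (p x) = p x := by
    intro x
    change p (inn X i (E (g x))) = _
    rw [hpf, hEE]; rfl
  have hrp : LinearMap.range p = (LinearMap.range E).map (inn X i) := by
    ext x
    constructor
    · rintro ⟨x, rfl⟩
      exact ⟨E (g x), ⟨_, rfl⟩, rfl⟩
    · rintro ⟨_, ⟨y, rfl⟩, rfl⟩
      exact ⟨inn X i y, hpf y⟩
  have hmap : (LinearMap.range (ε i)).map (kap X i) = LinearMap.ker (inn X i) ⊓ LinearMap.range E := by
    ext y
    constructor
    · rintro ⟨_, ⟨z, rfl⟩, rfl⟩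
      exact ⟨inn_kap X i _, ⟨kap X i z, hEk z⟩⟩
    · rintro ⟨h1, ⟨w, rfl⟩⟩
      obtain ⟨z, hz⟩ := exists_kap X i (E w) (hE0 w) h1
      refine ⟨ε i z, ⟨z, rfl⟩, ?_⟩
      rw [← hEk, hz, hEE]
  have hrq : ∀ j, j ≠ i → finrank K (LinearMap.range (q j)) = finrank K (LinearMap.range (ε j)) := by
    intro j hj
    have h1 : LinearMap.range (q j) = (LinearMap.range (ε j)).map (pr X i j) := by
      ext x
      constructor
      · rintro ⟨x, rfl⟩
        exact ⟨ε j (io X i j x), ⟨_, rfl⟩, rfl⟩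
      · rintro ⟨_, ⟨y, rfl⟩, rfl⟩
        exact ⟨pr X i j y, by simp only [q, LinearMap.comp_apply, io_pr X hj]⟩
    rw [h1, finrank_map_inj _ (Function.LeftInverse.injective (io_pr X hj))]
  refine ⟨Function.update q i p, ⟨fun j x => ?_, fun a b x => ?_⟩, ?_⟩
  · by_cases hj : j = i
    · subst hj; simpa using hpp x
    · simpa [Function.update_of_ne hj] using hq j hj x
  · by_cases ha : a = i
    · subst ha
      rw [hX a b (hs.1 b)]; simp
    by_cases hb : b = i
    · subst hb
      rw [Function.update_self, Function.update_of_ne ha]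
      cases hk : adj b a
      · rw [hX a b (hs.2 a hk)]; simp
      have hsing : ∀ x, inn X b (Pi.single a x) = X.φ a b x := by
        intro x
        rw [inn_apply, Finset.sum_eq_single a]
        · simp
        · intro k _ hk; simp [hk]
        · simp
      rw [← hsing, hpf, ← hsing]
      congr 1
      funext k
      by_cases hka : k = a
      · subst hka
        rw [hE1 _ k hk]; simp
      · simp [E, hka]
    · rw [Function.update_of_ne ha, Function.update_of_ne hb]
      simp only [q, LinearMap.comp_apply]
      rw [← pr_phi X ha hb, ← hc]
      congr 2
      rw [← io_pr X hb ((refl i X).φ a b _), pr_phi X ha hb, pr_io X ha]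
  · funext j
    by_cases hj : j = i
    · subst hj
      simp only [rk, sr]
      rw [Function.update_self, Function.update_self]
      have h1 := finrank_map_add (inn X j) (LinearMap.range E)
      rw [← hmap, ← hrp, finrank_map_inj _ (kap_inj X j), finrank_range_pi] at h1
      have h2 : (∑ k, finrank K (LinearMap.range (Ek k)) : ℕ) =
          ∑ k, if adj j k then finrank K (LinearMap.range (ε k)) else 0 := by
        refine Finset.sum_congr rfl fun k _ => ?_
        cases hk : adj j k
        · have : Ek k = 0 := by simp [Ek, hk]
          rw [this]; simp
        · have : Ek k = q k := by simp [Ek, hk]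
          rw [this, hrq k (hne k hk)]; simp
      rw [h2] at h1
      have h3 : ((∑ k, if adj j k then finrank K (LinearMap.range (ε k)) else 0 : ℕ) : ℤ) =
          ∑ k, if adj j k then (finrank K (LinearMap.range (ε k)) : ℤ) else 0 := by
        push_cast; rfl
      rw [← h3, ← h1]
      push_cast
      ring
    · simp only [rk, sr]
      rw [Function.update_of_ne hj, Function.update_of_ne hj, hrq j hj]; rfl

def refls : List (Fin 8) → Rep.{u} K → Rep.{u} K
  | [], X => X
  | i :: w, X => refls w (refl i X)

lemma exists_idem (w : List (Fin 8)) : ∀ (o : Fin 8 → Fin 8 → Bool) (X : Rep.{u} K),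
    Adm o w → Supp o X → ∃ ε, Idem X ε ∧ rk ε = sw w (dm (refls w X)) := by
  induction w with
  | nil =>
    intro o X _ _
    refine ⟨fun j => LinearMap.id, ⟨fun _ _ => rfl, fun _ _ _ => rfl⟩, ?_⟩
    funext j
    change ((finrank K (LinearMap.range (LinearMap.id : X.M j →ₗ[K] X.M j)) : ℕ) : ℤ) =
      (finrank K (X.M j) : ℤ)
    rw [LinearMap.range_id, finrank_top]
  | cons i w ih =>
    intro o X ha hX
    obtain ⟨ε, hε, hr⟩ := ih _ (refl i X) ha.2 (supp_refl hX i)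
    obtain ⟨ε', hε', hr'⟩ := lift hX ha.1 ε hε
    exact ⟨ε', hε', by rw [hr', hr]; rfl⟩

lemma refls_zero (X : Rep.{u} K) (hX : Supp o0 X) (j : Fin 8) :
    finrank K ((refls (word 15) X).M j) = 0 := by
  obtain ⟨ε, -, h⟩ := exists_idem (word 15) o0 X (adm_word 15) hX
  rw [sw_final] at h
  have := congrFun h j
  simp only [rk, dm, Pi.neg_apply] at this
  omega

noncomputable def inv : List (Fin 8) → Rep.{u} K → List ℕ
  | [], _ => []
  | i :: w, X => finrank K (X.M i) :: inv w (refl i X)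

lemma iso_of_inv (w : List (Fin 8)) : ∀ (o : Fin 8 → Fin 8 → Bool) (X Y : Rep.{u} K),
    Adm o w → Supp o X → Supp o Y → (∀ j, finrank K ((refls w X).M j) = 0) →
    (∀ j, finrank K ((refls w Y).M j) = 0) → inv w X = inv w Y → Iso X Y := by
  induction w with
  | nil =>
    intro o X Y _ _ _ h1 h2 _
    have : ∀ j, Subsingleton (X.M j) := fun j => (Module.finrank_zero_iff (M := X.M j) (R := K)).1 (h1 j)
    have : ∀ j, Subsingleton (Y.M j) := fun j => (Module.finrank_zero_iff (M := Y.M j) (R := K)).1 (h2 j)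
    refine ⟨fun j => 0, fun j => ⟨fun _ _ _ => Subsingleton.elim _ _,
      fun y => ⟨0, Subsingleton.elim _ _⟩⟩, fun _ _ _ => Subsingleton.elim _ _⟩
  | cons i w ih =>
    intro o X Y ha hX hY h1 h2 h
    simp only [inv, List.cons.injEq] at h
    exact iso_of_refl hX hY ha.1 h.1
      (ih _ _ _ ha.2 (supp_refl hX i) (supp_refl hY i) h1 h2 h.2)

lemma inv_finite (w : List (Fin 8)) : ∀ D : ℕ, ∃ B : Set (List ℕ), B.Finite ∧
    ∀ X : Rep.{u} K, (∀ j, finrank K (X.M j) ≤ D) → inv w X ∈ B := by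
  induction w with
  | nil => exact fun D => ⟨{[]}, Set.finite_singleton _, fun X _ => rfl⟩
  | cons i w ih =>
    intro D
    obtain ⟨B, hB, h⟩ := ih (D + 8 * D)
    refine ⟨Set.image2 List.cons (Set.Iic D) B, (Set.finite_Iic D).image2 _ hB, fun X hX => ?_⟩
    refine ⟨_, hX i, _, h _ fun j => ?_, rfl⟩
    refine (Submodule.finrank_le (S X i j)).trans ?_
    rw [Module.finrank_prod, Module.finrank_pi_fintype]
    refine Nat.add_le_add (hX j) ?_
    refine (Finset.sum_le_card_nsmul _ _ D fun k _ => hX k).trans ?_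
    simp


variable {V : Type u} [AddCommGroup V] [Module K V] [FiniteDimensional K V]

open Classical in
/-- the representation attached to a configuration of subspaces. -/
noncomputable def cf (F : Fin 8 → Submodule K V) : Rep.{u} K where
  M j := F j
  φ a b := if h : o0 a b = true ∧ F a ≤ F b then Submodule.inclusion h.2 else 0

lemma supp_cf (F : Fin 8 → Submodule K V) : Supp o0 (cf F) := by
  intro a b h
  simp [cf, h]
  rfl

lemma cf_iso (F G : Fin 8 → Submodule K V) (hF0 : F 0 = ⊤) (hG0 : G 0 = ⊤)
    (hF : ∀ a b, o0 a b = true → F a ≤ F b) (hG : ∀ a b, o0 a b = true → G a ≤ G b)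
    (h : Iso (cf F) (cf G)) : ∃ g : V ≃ₗ[K] V, ∀ j, (F j).map g.toLinearMap = G j := by
  obtain ⟨e, he, hc⟩ := h
  let e' : ∀ j, F j →ₗ[K] G j := e
  have he' : ∀ j, Function.Bijective (e' j) := he
  let g0 : V →ₗ[K] V := (G 0).subtype ∘ₗ e' 0 ∘ₗ
    LinearMap.codRestrict (F 0) LinearMap.id (fun v => by rw [hF0]; trivial)
  have hg0 : Function.Injective g0 := by
    intro v w h
    have h1 := (he' 0).1 (Subtype.ext h)
    exact congrArg Subtype.val h1
  let g : V ≃ₗ[K] V := LinearEquiv.ofInjectiveEndo g0 hg0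
  have hstep : ∀ a b, o0 a b = true → (∀ x : F b, (e' b x : V) = g x) →
      ∀ x : F a, (e' a x : V) = g x := by
    intro a b hab hb x
    have h1 : ∀ x, (cf F).φ a b x = Submodule.inclusion (hF a b hab) x := by
      intro x; simp [cf, hab, hF a b hab]; rfl
    have h2 : ∀ x, (cf G).φ a b x = Submodule.inclusion (hG a b hab) x := by
      intro x; simp [cf, hab, hG a b hab]; rfl
    have h3 := hc a b x
    have h3 := (congrArg (e b) (h1 x)).symm.trans (h3.trans (h2 (e a x)))
    have h4 := congrArg (fun z : G b => (z : V)) h3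
    exact h4.symm.trans (hb _)
  have k0 : ∀ x : F 0, (e' 0 x : V) = g x := fun x => rfl
  have k1 := hstep 1 0 (by decide) k0
  have k3 := hstep 3 0 (by decide) k0
  have k2 := hstep 2 3 (by decide) k3
  have k7 := hstep 7 0 (by decide) k0
  have k6 := hstep 6 7 (by decide) k7
  have k5 := hstep 5 6 (by decide) k6
  have k4 := hstep 4 5 (by decide) k5
  have hall : ∀ j, ∀ x : F j, (e' j x : V) = g x := by
    intro j
    fin_cases j
    exacts [k0, k1, k2, k3, k4, k5, k6, k7]
  refine ⟨g, fun j => ?_⟩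
  ext v
  constructor
  · rintro ⟨x, hx, rfl⟩
    have := hall j ⟨x, hx⟩
    change g x ∈ G j
    rw [← this]
    exact Subtype.property _
  · intro hv
    obtain ⟨x, hx⟩ := (he' j).2 ⟨v, hv⟩
    refine ⟨x, x.2, ?_⟩
    change g x = v
    rw [← hall j x, hx]

/-- the family of subspaces of a configuration, with the last flag padded to length four. -/
def fam {ℓ : ℕ} (hl : 1 ≤ ℓ)
    (x : Submodule K V × (Submodule K V × Submodule K V) × (Fin ℓ → Submodule K V)) :
    Fin 8 → Submodule K V :=
  ![⊤, x.1, x.2.1.1, x.2.1.2, x.2.2 ⟨min 0 (ℓ - 1), by omega⟩, x.2.2 ⟨min 1 (ℓ - 1), by omega⟩,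
    x.2.2 ⟨min 2 (ℓ - 1), by omega⟩, x.2.2 ⟨min 3 (ℓ - 1), by omega⟩]

lemma fam_le {ℓ : ℕ} (hl : 1 ≤ ℓ)
    (x : Submodule K V × (Submodule K V × Submodule K V) × (Fin ℓ → Submodule K V))
    (hB : x.2.1.1 ≤ x.2.1.2) (hC : Monotone x.2.2) (a b : Fin 8) (h : o0 a b = true) :
    fam hl x a ≤ fam hl x b := by
  simp only [o0, decide_eq_true_eq, List.mem_cons, Prod.mk.injEq, List.not_mem_nil, or_false] at h
  rcases h with ⟨rfl, rfl⟩ | ⟨rfl, rfl⟩ | ⟨rfl, rfl⟩ | ⟨rfl, rfl⟩ | ⟨rfl, rfl⟩ | ⟨rfl, rfl⟩ |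
    ⟨rfl, rfl⟩
  · exact le_top
  · exact hB
  · exact le_top
  · exact hC (Fin.mk_le_mk.2 (by omega))
  · exact hC (Fin.mk_le_mk.2 (by omega))
  · exact hC (Fin.mk_le_mk.2 (by omega))
  · exact le_top

end

end E8

/-- GL(V) has finitely many orbits on configurations `(A, B₁ ⊆ B₂, C₁ ⊆ ⋯ ⊆ C_ℓ)`
with `1 ≤ ℓ ≤ 4`. -/
theorem finitely_many_orbits_one_two_ell_le_four
    (K : Type*) [Field K] [IsAlgClosed K] (V : Type*) [AddCommGroup V] [Module K V]
    [FiniteDimensional K V] (n ℓ a b1 b2 : ℕ) (hn : finrank K V = n)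
    (hl1 : 1 ≤ ℓ) (hl4 : ℓ ≤ 4)
    (c : Fin ℓ → ℕ) (hc : StrictMono c)
    (ha0 : 0 < a) (han : a < n)
    (hb10 : 0 < b1) (hb12 : b1 < b2) (hb2n : b2 < n)
    (hc0 : ∀ j, 0 < c j) (hcn : ∀ j, c j < n) :
    { O : Set (Submodule K V × (Submodule K V × Submodule K V) × (Fin ℓ → Submodule K V)) |
        ∃ x : Submodule K V × (Submodule K V × Submodule K V) × (Fin ℓ → Submodule K V),
          (finrank K x.1 = a ∧
            x.2.1.1 ≤ x.2.1.2 ∧ finrank K x.2.1.1 = b1 ∧ finrank K x.2.1.2 = b2 ∧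
            Monotone x.2.2 ∧ (∀ j, finrank K (x.2.2 j) = c j)) ∧
          O = { x' | ∃ g : V ≃ₗ[K] V,
            x.1.map g.toLinearMap = x'.1 ∧
            x.2.1.1.map g.toLinearMap = x'.2.1.1 ∧
            x.2.1.2.map g.toLinearMap = x'.2.1.2 ∧
            ∀ j, (x.2.2 j).map g.toLinearMap = x'.2.2 j } }.Finite := by
  classical
  set T := { O : Set (Submodule K V × (Submodule K V × Submodule K V) × (Fin ℓ → Submodule K V)) |
        ∃ x : Submodule K V × (Submodule K V × Submodule K V) × (Fin ℓ → Submodule K V),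
          (finrank K x.1 = a ∧
            x.2.1.1 ≤ x.2.1.2 ∧ finrank K x.2.1.1 = b1 ∧ finrank K x.2.1.2 = b2 ∧
            Monotone x.2.2 ∧ (∀ j, finrank K (x.2.2 j) = c j)) ∧
          O = { x' | ∃ g : V ≃ₗ[K] V,
            x.1.map g.toLinearMap = x'.1 ∧
            x.2.1.1.map g.toLinearMap = x'.2.1.1 ∧
            x.2.1.2.map g.toLinearMap = x'.2.1.2 ∧
            ∀ j, (x.2.2 j).map g.toLinearMap = x'.2.2 j } } with hT
  obtain ⟨B, hB, hBX⟩ := E8.inv_finite (K := K) (E8.word 15) (finrank K V)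
  have hch : ∀ O : T, ∃ x : Submodule K V × (Submodule K V × Submodule K V) ×
      (Fin ℓ → Submodule K V), _ := fun O => O.2
  choose x hx hO using hch
  have key : ∀ O O' : T, E8.inv (E8.word 15) (E8.cf (E8.fam hl1 (x O))) =
      E8.inv (E8.word 15) (E8.cf (E8.fam hl1 (x O'))) → O.1 ⊆ O'.1 := by
    intro O O' h
    have hiso := E8.iso_of_inv (E8.word 15) E8.o0 _ _ (E8.adm_word 15)
      (E8.supp_cf _) (E8.supp_cf _) (E8.refls_zero _ (E8.supp_cf _))
      (E8.refls_zero _ (E8.supp_cf _)) h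
    obtain ⟨g, hg⟩ := E8.cf_iso _ _ rfl rfl
      (E8.fam_le hl1 (x O) (hx O).2.1 (hx O).2.2.2.2.1)
      (E8.fam_le hl1 (x O') (hx O').2.1 (hx O').2.2.2.2.1) hiso
    have inv1 : ∀ (S S' S'' : Submodule K V) (k : V ≃ₗ[K] V), S.map g.toLinearMap = S' →
        S.map k.toLinearMap = S'' → S'.map (g.symm.trans k).toLinearMap = S'' := by
      rintro S _ _ k rfl rfl
      ext v
      simp [Submodule.mem_map]
    have g1 : (x O).1.map g.toLinearMap = (x O').1 := hg 1
    have g2 : (x O).2.1.1.map g.toLinearMap = (x O').2.1.1 := hg 2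
    have g3 : (x O).2.1.2.map g.toLinearMap = (x O').2.1.2 := hg 3
    have g4 : ∀ j, ((x O).2.2 j).map g.toLinearMap = (x O').2.2 j := by
      intro j
      have hj := j.2
      obtain h | h | h | h : j.1 = 0 ∨ j.1 = 1 ∨ j.1 = 2 ∨ j.1 = 3 := by omega
      · have e : j = ⟨min 0 (ℓ - 1), by omega⟩ := Fin.ext (by simp only; omega)
        rw [e]; exact hg 4
      · have e : j = ⟨min 1 (ℓ - 1), by omega⟩ := Fin.ext (by simp only; omega)
        rw [e]; exact hg 5
      · have e : j = ⟨min 2 (ℓ - 1), by omega⟩ := Fin.ext (by simp only; omega)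
        rw [e]; exact hg 6
      · have e : j = ⟨min 3 (ℓ - 1), by omega⟩ := Fin.ext (by simp only; omega)
        rw [e]; exact hg 7
    rw [hO O, hO O']
    rintro y ⟨k, k1, k2, k3, k4⟩
    exact ⟨g.symm.trans k, inv1 _ _ _ k g1 k1, inv1 _ _ _ k g2 k2, inv1 _ _ _ k g3 k3,
      fun j => inv1 _ _ _ k (g4 j) (k4 j)⟩
  have hBf : Finite B := hB
  let f : T → B := fun O => ⟨E8.inv (E8.word 15) (E8.cf (E8.fam hl1 (x O))),
    hBX _ fun j => Submodule.finrank_le (E8.fam hl1 (x O) j)⟩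
  have hf : Function.Injective f := by
    intro O O' h
    have h' := congrArg Subtype.val h
    exact Subtype.ext (Set.Subset.antisymm (key O O' h') (key O' O h'.symm))
  exact Finite.of_injective f hf
end
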